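/- arXiv:math/0312083 — 3 statements merged into one kernel-verified Lean document; each statement's English description precedes it below -/
import Mathlib

section
/- Let m > n ≥ 1, let A be a real m×n matrix of rank n, let b ∈ ℝ^m, let c ∈ ℝ^n be nonzero, and let u ∈ ℝ^n, v ∈ ℝ^m, w ∈ ℝ^m be not all zero. Then the set of points z = (x, s, y, ẋ, ṡ, ẏ, μ) ∈ ℝ^n × ℝ^m × ℝ^m × ℝ^n × ℝ^m × ℝ^m × ℝ with μ > 0, Φ^{A,b,c,u,v,w}(z) = 0, and the derivative DΦ^{A,b,c,u,v,w}(z) invertible, has cardinality at most 2·n·C(m−1,n), where C(m−1,n) is the binomial coefficient. -/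
/-- The space of variables `(x, s, y, ẋ, ṡ, ẏ, μ)` of the central-path system. -/
abbrev CPVars (K : Type) (m n : ℕ) :=
  (Fin n → K) × (Fin m → K) × (Fin m → K) × (Fin n → K) × (Fin m → K) × (Fin m → K) × K

/-- The polynomial map `Φ^{A,b,c,u,v,w}` whose zeros with `μ > 0` and transversal
hyperplane data `(u,v,w)` encode the transversal intersections of the Gauss curve
of the primal/dual central path with the hyperplane `uᵀẋ + vᵀṡ + wᵀẏ = 0`. -/
noncomputable def cpPhi {m n : ℕ} (A : Matrix (Fin m) (Fin n) ℝ)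
    (b : Fin m → ℝ) (c : Fin n → ℝ) (u : Fin n → ℝ) (v w : Fin m → ℝ)
    (z : CPVars ℝ m n) :
    (Fin m → ℝ) × (Fin n → ℝ) × (Fin m → ℝ) × (Fin m → ℝ) × (Fin n → ℝ) × (Fin m → ℝ) × ℝ :=
  (A.mulVec z.1 - z.2.1 - b,
   A.transpose.mulVec z.2.2.1 - c,
   (fun i => z.2.1 i * z.2.2.1 i - z.2.2.2.2.2.2),
   A.mulVec z.2.2.2.1 - z.2.2.2.2.1,
   A.transpose.mulVec z.2.2.2.2.2.1,
   (fun i => z.2.2.2.2.1 i * z.2.2.1 i + z.2.1 i * z.2.2.2.2.2.1 i - 1),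
   (∑ j, u j * z.2.2.2.1 j) + (∑ i, v i * z.2.2.2.2.1 i) + (∑ i, w i * z.2.2.2.2.2.1 i))
namespace CPB
open Submodule

section alg
variable {R : Type*} [CommRing R] [Algebra ℝ R]

/-- moment curve -/
noncomputable def mom {n : ℕ} (e : Fin (n+1) → R) (t : ℕ) : R :=
  ∑ j : Fin (n+1), ((t:ℝ)^(j:ℕ)) • e j

lemma mom_mem {n : ℕ} (e : Fin (n+1) → R) (t : ℕ) : mom e t ∈ span ℝ (Set.range e) :=
  Submodule.sum_mem _ fun j _ => Submodule.smul_mem _ _ (Submodule.subset_span ⟨j, rfl⟩)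

lemma gp1 {n : ℕ} (e : Fin (n+1) → R) (S : Finset ℕ) (hS : n + 1 ≤ S.card) :
    span ℝ (Set.range e) ≤ span ℝ (mom e '' S) := by
  obtain ⟨S', hS', hc⟩ := Finset.exists_subset_card_eq hS
  let o := S'.orderEmbOfFin hc
  let V : Matrix (Fin (n+1)) (Fin (n+1)) ℝ := Matrix.vandermonde fun i => ((o i : ℕ) : ℝ)
  have hV : IsUnit V.det := by
    rw [isUnit_iff_ne_zero, Matrix.det_vandermonde_ne_zero_iff]
    intro i j h
    have h' : ((o i : ℕ) : ℝ) = (o j : ℕ) := h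
    exact o.injective (by exact_mod_cast h')
  rw [Submodule.span_le]
  rintro _ ⟨j, rfl⟩
  have key : e j = ∑ i, (V⁻¹ j i) • mom e (o i) := by
    have h1 : ∀ i, mom e (o i) = ∑ l, V i l • e l := fun i => by
      simp [mom, V, Matrix.vandermonde_apply]
    simp_rw [h1, Finset.smul_sum, smul_smul]
    rw [Finset.sum_comm]
    simp_rw [← Finset.sum_smul, ← Matrix.mul_apply, Matrix.nonsing_inv_mul V hV]
    simp [Matrix.one_apply]
  rw [SetLike.mem_coe, key]
  refine Submodule.sum_mem _ fun i _ => Submodule.smul_mem _ _ (Submodule.subset_span ⟨o i, ?_, rfl⟩)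
  exact hS' (Finset.orderEmbOfFin_mem S' hc i)

/-- the span of the first `k` products -/
noncomputable def PP {n k : ℕ} (e : Fin (n+1) → R) (e' : Fin (k+1) → R) (r : ℕ) : Submodule ℝ R :=
  span ℝ ((fun t => mom e t * mom e' t) '' (Finset.range r))

noncomputable def JJ {n k : ℕ} (e : Fin (n+1) → R) (e' : Fin (k+1) → R) (S T : Finset ℕ)
    (r d c : ℕ) : Submodule ℝ R :=
  span ℝ (mom e '' S) * (span ℝ (Set.range e) ^ d * span ℝ (Set.range e') ^ (c+1))
  + span ℝ (mom e' '' T) * (span ℝ (Set.range e) ^ (d+1) * span ℝ (Set.range e') ^ c)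
  + PP e e' r * (span ℝ (Set.range e) ^ d * span ℝ (Set.range e') ^ c)

def bet (n a r : ℕ) : ℕ := if a ≤ n then r.choose (n - a) else 0

lemma leaf {X Y L1 L2 : Submodule ℝ R} {a b : R} (hX : L1 ≤ X + span ℝ {a})
    (hY : L2 ≤ Y + span ℝ {b}) (hb : span ℝ {b} ≤ L2 ) (ha : span ℝ {a} ≤ L1) (d c : ℕ) :
    L1 ^ (d+1) * L2 ^ (c+1) ≤ X * (L1 ^ d * L2 ^ (c+1)) + Y * (L1 ^ (d+1) * L2 ^ c)
      + span ℝ {a ^ (d+1) * b ^ (c+1)} := by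
  have h1 : ∀ d, L1 ^ (d+1) ≤ X * L1 ^ d + span ℝ {a} ^ (d+1) := by
    intro d
    induction d with
    | zero => simpa using hX
    | succ d ih =>
      calc L1 ^ (d+1+1) = L1 * L1 ^ (d+1) := by ring
        _ ≤ (X + span ℝ {a}) * L1 ^ (d+1) := by gcongr
        _ = X * L1 ^ (d+1) + span ℝ {a} * L1 ^ (d+1) := by ring
        _ ≤ X * L1 ^ (d+1) + span ℝ {a} * (X * L1 ^ d + span ℝ {a} ^ (d+1)) := by gcongr
        _ = X * L1 ^ (d+1) + span ℝ {a} * (X * L1 ^ d) + span ℝ {a} ^ (d+1+1) := by ring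
        _ ≤ X * L1 ^ (d+1) + L1 * (X * L1 ^ d) + span ℝ {a} ^ (d+1+1) := by gcongr
        _ = X * L1 ^ (d+1) + X * L1 ^ (d+1) + span ℝ {a} ^ (d+1+1) := by ring
        _ = _ := by rw [add_idem]
  have h2 : ∀ d, L2 ^ (d+1) ≤ Y * L2 ^ d + span ℝ {b} ^ (d+1) := by
    intro d
    induction d with
    | zero => simpa using hY
    | succ d ih =>
      calc L2 ^ (d+1+1) = L2 * L2 ^ (d+1) := by ring
        _ ≤ (Y + span ℝ {b}) * L2 ^ (d+1) := by gcongr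
        _ = Y * L2 ^ (d+1) + span ℝ {b} * L2 ^ (d+1) := by ring
        _ ≤ Y * L2 ^ (d+1) + span ℝ {b} * (Y * L2 ^ d + span ℝ {b} ^ (d+1)) := by gcongr
        _ = Y * L2 ^ (d+1) + span ℝ {b} * (Y * L2 ^ d) + span ℝ {b} ^ (d+1+1) := by ring
        _ ≤ Y * L2 ^ (d+1) + L2 * (Y * L2 ^ d) + span ℝ {b} ^ (d+1+1) := by gcongr
        _ = Y * L2 ^ (d+1) + Y * L2 ^ (d+1) + span ℝ {b} ^ (d+1+1) := by ring
        _ = _ := by rw [add_idem]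
  have h3 : span ℝ {a ^ (d+1) * b ^ (c+1)} = span ℝ {a} ^ (d+1) * span ℝ {b} ^ (c+1) := by
    rw [Submodule.span_pow, Submodule.span_pow, Set.singleton_pow, Set.singleton_pow,
      Submodule.span_mul_span, Set.singleton_mul_singleton]
  rw [h3]
  calc L1 ^ (d+1) * L2 ^ (c+1) ≤ (X * L1 ^ d + span ℝ {a} ^ (d+1)) * L2 ^ (c+1) := by gcongr; exact h1 d
    _ = X * (L1 ^ d * L2 ^ (c+1)) + span ℝ {a} ^ (d+1) * L2 ^ (c+1) := by ring
    _ ≤ X * (L1 ^ d * L2 ^ (c+1)) + span ℝ {a} ^ (d+1) * (Y * L2 ^ c + span ℝ {b} ^ (c+1)) := by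
        gcongr; exact h2 c
    _ = X * (L1 ^ d * L2 ^ (c+1)) + span ℝ {a} ^ (d+1) * (Y * L2 ^ c)
        + span ℝ {a} ^ (d+1) * span ℝ {b} ^ (c+1) := by ring
    _ ≤ X * (L1 ^ d * L2 ^ (c+1)) + L1 ^ (d+1) * (Y * L2 ^ c)
        + span ℝ {a} ^ (d+1) * span ℝ {b} ^ (c+1) := by gcongr
    _ = _ := by ring

lemma main_claim {n k : ℕ} (e : Fin (n+1) → R) (e' : Fin (k+1) → R) (r : ℕ) :
    ∀ (S T : Finset ℕ), (∀ t < r, t ∉ S) → (∀ t < r, t ∉ T) → S.card + T.card + r = n + k →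
    ∀ d c : ℕ, r ≤ d → ∃ t : Finset R, t.card ≤ bet n S.card r ∧
      span ℝ (Set.range e) ^ (d+1) * span ℝ (Set.range e') ^ (c+1) ≤
        JJ e e' S T r d c + span ℝ (t : Set R) := by
  classical
  induction r with
  | zero =>
    intro S T _ _ hST d c _
    by_cases h1 : n + 1 ≤ S.card
    · refine ⟨∅, by simp, ?_⟩
      have := gp1 e S h1
      calc span ℝ (Set.range e) ^ (d+1) * span ℝ (Set.range e') ^ (c+1)
          = span ℝ (Set.range e) * (span ℝ (Set.range e) ^ d * span ℝ (Set.range e') ^ (c+1)) := by ring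
        _ ≤ span ℝ (mom e '' S) * (span ℝ (Set.range e) ^ d * span ℝ (Set.range e') ^ (c+1)) := by
          gcongr
        _ ≤ _ := by
          unfold JJ
          simp only [Submodule.add_eq_sup]
          exact le_sup_left.trans (le_sup_left.trans le_sup_left)
    by_cases h2 : S.card = n
    · obtain ⟨t, ht⟩ := Infinite.exists_notMem_finset S
      obtain ⟨t', ht'⟩ := Infinite.exists_notMem_finset T
      have key : ∀ {n : ℕ} (e : Fin (n+1) → R) (S : Finset ℕ), n ≤ S.card → ∀ t, t ∉ S →
          span ℝ (Set.range e) ≤ span ℝ (mom e '' S) + span ℝ {mom e t} := by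
        intro n e S hS t ht
        refine (gp1 e (insert t S) ?_).trans ?_
        · rw [Finset.card_insert_of_notMem ht]; omega
        · rw [Finset.coe_insert, Set.image_insert_eq, Submodule.span_insert, add_comm,
            Submodule.add_eq_sup]
      refine ⟨{mom e t ^ (d+1) * mom e' t' ^ (c+1)}, by simp [bet, h2], ?_⟩
      refine (leaf (key e S h2.ge t ht) (key e' T (by omega) t' ht') ?_ ?_ d c).trans ?_
      · rw [Submodule.span_singleton_le_iff_mem]; exact mom_mem e' t'
      · rw [Submodule.span_singleton_le_iff_mem]; exact mom_mem e t
      · unfold JJ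
        simp only [Submodule.add_eq_sup, Finset.coe_singleton]
        exact sup_le_sup_right le_sup_left _
    · refine ⟨∅, by simp, ?_⟩
      have := gp1 e' T (by omega)
      calc span ℝ (Set.range e) ^ (d+1) * span ℝ (Set.range e') ^ (c+1)
          = span ℝ (Set.range e') * (span ℝ (Set.range e) ^ (d+1) * span ℝ (Set.range e') ^ c) := by ring
        _ ≤ span ℝ (mom e' '' T) * (span ℝ (Set.range e) ^ (d+1) * span ℝ (Set.range e') ^ c) := by
          gcongr
        _ ≤ _ := by
          unfold JJ
          simp only [Submodule.add_eq_sup]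
          exact le_sup_right.trans (le_sup_left.trans le_sup_left)
  | succ r ih =>
    intro S T hS hT hST d c hd
    obtain ⟨d, rfl⟩ : ∃ d', d = d' + 1 := ⟨d - 1, by omega⟩
    obtain ⟨t1, ht1, h1⟩ := ih (insert r S) T
      (fun t ht => by
        rw [Finset.mem_insert]; rintro (h | h)
        · omega
        · exact hS t (by omega) h) (fun t ht => hT t (by omega))
      (by rw [Finset.card_insert_of_notMem (hS r (by omega))]; omega) (d+1) c (by omega)
    obtain ⟨t2, ht2, h2⟩ := ih S (insert r T) (fun t ht => hS t (by omega))
      (fun t ht => by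
        rw [Finset.mem_insert]; rintro (h | h)
        · omega
        · exact hT t (by omega) h)
      (by rw [Finset.card_insert_of_notMem (hT r (by omega))]; omega) d c (by omega)
    rw [Finset.card_insert_of_notMem (hS r (by omega))] at ht1
    refine ⟨t1 ∪ t2.image (fun x => mom e r * x), ?_, ?_⟩
    · refine (Finset.card_union_le _ _).trans ?_
      refine (add_le_add ht1 (Finset.card_image_le.trans ht2)).trans ?_
      unfold bet
      split_ifs with h h' h'
      · obtain ⟨q, hq⟩ : ∃ q, n - S.card = q + 1 := ⟨n - S.card - 1, by omega⟩
        rw [hq, show n - (S.card + 1) = q by omega, Nat.choose_succ_succ]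
      · omega
      · rw [show n - S.card = 0 by omega]; simp
      · simp
    · have hsp : span ℝ ((t1 ∪ t2.image (fun x => mom e r * x) : Finset R) : Set R)
          = span ℝ (t1 : Set R) + span ℝ {mom e r} * span ℝ (t2 : Set R) := by
        rw [Finset.coe_union, Submodule.span_union, Submodule.add_eq_sup, Submodule.span_mul_span,
          Finset.coe_image, Set.singleton_mul]
      have hiS : span ℝ (mom e '' ((insert r S : Finset ℕ) : Set ℕ)) =
          span ℝ {mom e r} + span ℝ (mom e '' S) := by
        rw [Finset.coe_insert, Set.image_insert_eq, Submodule.span_insert, Submodule.add_eq_sup]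
      have hiT : span ℝ (mom e' '' ((insert r T : Finset ℕ) : Set ℕ)) =
          span ℝ {mom e' r} + span ℝ (mom e' '' T) := by
        rw [Finset.coe_insert, Set.image_insert_eq, Submodule.span_insert, Submodule.add_eq_sup]
      have hPP : PP e e' (r+1) = span ℝ {mom e r} * span ℝ {mom e' r} + PP e e' r := by
        unfold PP
        rw [Finset.range_add_one, Finset.coe_insert, Set.image_insert_eq, Submodule.span_insert,
          Submodule.add_eq_sup, Submodule.span_mul_span, Set.singleton_mul_singleton]
      have hL : span ℝ {mom e r} ≤ span ℝ (Set.range e) := by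
        rw [Submodule.span_singleton_le_iff_mem]; exact mom_mem e r
      rw [hsp]
      unfold JJ at h1 h2 ⊢
      rw [hiS] at h1
      rw [hiT] at h2
      rw [hPP]
      generalize span ℝ (mom e '' S) = X at *
      generalize span ℝ (mom e' '' T) = Y at *
      generalize span ℝ {mom e r} = a at *
      generalize span ℝ {mom e' r} = b at *
      generalize PP e e' r = P at *
      generalize span ℝ (Set.range e) = L1 at *
      generalize span ℝ (Set.range e') = L2 at *
      generalize span ℝ (t1 : Set R) = s1 at *
      generalize span ℝ (t2 : Set R) = s2 at *
      calc _ ≤ _ := h1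
        _ = a * (L1 ^ (d+1) * L2 ^ (c+1)) + (X * (L1 ^ (d+1) * L2 ^ (c+1))
            + Y * (L1 ^ (d+1+1) * L2 ^ c) + P * (L1 ^ (d+1) * L2 ^ c) + s1) := by ring
        _ ≤ a * ((X * (L1 ^ d * L2 ^ (c+1)) + (b + Y) * (L1 ^ (d+1) * L2 ^ c)
            + P * (L1 ^ d * L2 ^ c)) + s2) + (X * (L1 ^ (d+1) * L2 ^ (c+1))
            + Y * (L1 ^ (d+1+1) * L2 ^ c) + P * (L1 ^ (d+1) * L2 ^ c) + s1) := by gcongr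
        _ = a * (X * (L1 ^ d * L2 ^ (c+1)) + Y * (L1 ^ (d+1) * L2 ^ c)
            + P * (L1 ^ d * L2 ^ c)) + (a * (b * (L1 ^ (d+1) * L2 ^ c)) + a * s2 
            + (X * (L1 ^ (d+1) * L2 ^ (c+1))
            + Y * (L1 ^ (d+1+1) * L2 ^ c) + P * (L1 ^ (d+1) * L2 ^ c) + s1)) := by ring
        _ ≤ L1 * (X * (L1 ^ d * L2 ^ (c+1)) + Y * (L1 ^ (d+1) * L2 ^ c)
            + P * (L1 ^ d * L2 ^ c)) + (a * (b * (L1 ^ (d+1) * L2 ^ c)) + a * s2 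
            + (X * (L1 ^ (d+1) * L2 ^ (c+1))
            + Y * (L1 ^ (d+1+1) * L2 ^ c) + P * (L1 ^ (d+1) * L2 ^ c) + s1)) := by gcongr
        _ = (X * (L1 ^ (d+1) * L2 ^ (c+1)) + X * (L1 ^ (d+1) * L2 ^ (c+1))) 
            + (Y * (L1 ^ (d+1+1) * L2 ^ c) + Y * (L1 ^ (d+1+1) * L2 ^ c))
            + (P * (L1 ^ (d+1) * L2 ^ c) + P * (L1 ^ (d+1) * L2 ^ c))
            + a * b * (L1 ^ (d+1) * L2 ^ c) + a * s2 + s1 := by ring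
        _ = X * (L1 ^ (d+1) * L2 ^ (c+1)) + Y * (L1 ^ (d+1+1) * L2 ^ c)
            + P * (L1 ^ (d+1) * L2 ^ c) + a * b * (L1 ^ (d+1) * L2 ^ c) + a * s2 + s1 := by
            simp only [add_idem]
        _ = _ := by ring
        _ ≤ _ := le_rfl

lemma cover {n k : ℕ} (e : Fin (n+1) → R) (e' : Fin (k+1) → R) (d c : ℕ) (r : ℕ)
    (hr : r + 1 = n + k) (hd : r ≤ d) (b : ℕ) :
    ∃ h : R, h = (∏ j ∈ Finset.range k, mom e (r + j)) * ∏ j ∈ Finset.range b, mom e' (r + j) ∧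
    ∃ t : Finset R, t.card ≤ k * bet n 1 r + b * bet n 0 r ∧
      span ℝ (Set.range e) ^ (d+k+1) * span ℝ (Set.range e') ^ (c+b+1) ≤
        PP e e' r * (span ℝ (Set.range e) ^ (d+k) * span ℝ (Set.range e') ^ (c+b))
        + span ℝ {h} * (span ℝ (Set.range e) ^ (d+1) * span ℝ (Set.range e') ^ (c+1))
        + span ℝ (t : Set R) := by
  classical
  refine ⟨_, rfl, ?_⟩
  -- one factor
  have one1 : ∀ j d c, r ≤ d → ∃ t : Finset R, t.card ≤ bet n 1 r ∧
      span ℝ (Set.range e) ^ (d+1) * span ℝ (Set.range e') ^ (c+1) ≤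
        span ℝ {mom e (r+j)} * (span ℝ (Set.range e) ^ d * span ℝ (Set.range e') ^ (c+1)) +
        PP e e' r * (span ℝ (Set.range e) ^ d * span ℝ (Set.range e') ^ c) 
        + span ℝ (t : Set R) := by
    intro j d c hd
    obtain ⟨t, ht, h⟩ := main_claim e e' r {r+j} ∅ (by intro t ht; simp; omega) (by simp)
      (by simp; omega) d c hd
    refine ⟨t, by simpa using ht, ?_⟩
    simpa [JJ] using h
  have one2 : ∀ j d c, r ≤ d → ∃ t : Finset R, t.card ≤ bet n 0 r ∧
      span ℝ (Set.range e) ^ (d+1) * span ℝ (Set.range e') ^ (c+1) ≤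
        span ℝ {mom e' (r+j)} * (span ℝ (Set.range e) ^ (d+1) * span ℝ (Set.range e') ^ c) +
        PP e e' r * (span ℝ (Set.range e) ^ d * span ℝ (Set.range e') ^ c) 
        + span ℝ (t : Set R) := by
    intro j d c hd
    obtain ⟨t, ht, h⟩ := main_claim e e' r ∅ {r+j} (by simp) (by intro t ht; simp; omega)
      (by simp; omega) d c hd
    refine ⟨t, by simpa using ht, ?_⟩
    simpa [JJ] using h
  have m1 : ∀ a, span ℝ {∏ j ∈ Finset.range a, mom e (r + j)} ≤ span ℝ (Set.range e) ^ a := by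
    intro a
    rw [Submodule.span_singleton_le_iff_mem]
    induction a with
    | zero => simp [Submodule.one_le.mp le_rfl]
    | succ a ih => 
      rw [Finset.prod_range_succ, pow_succ]
      exact Submodule.mul_mem_mul ih (mom_mem _ _)
  have m2 : ∀ a, span ℝ {∏ j ∈ Finset.range a, mom e' (r + j)} ≤ span ℝ (Set.range e') ^ a := by
    intro a
    rw [Submodule.span_singleton_le_iff_mem]
    induction a with
    | zero => simp [Submodule.one_le.mp le_rfl]
    | succ a ih => 
      rw [Finset.prod_range_succ, pow_succ]
      exact Submodule.mul_mem_mul ih (mom_mem _ _)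
  have hsp : ∀ (t1 t2 : Finset R) (q : R), span ℝ ((t1 ∪ t2.image (fun x => q * x) : Finset R) : Set R)
          = span ℝ (t1 : Set R) + span ℝ {q} * span ℝ (t2 : Set R) := by
    intro t1 t2 q
    rw [Finset.coe_union, Submodule.span_union, Submodule.add_eq_sup, Submodule.span_mul_span,
          Finset.coe_image, Set.singleton_mul]
  have hmulspan : ∀ x y : R, span ℝ {x * y} = span ℝ {x} * span ℝ {y} := by
    intro x y
    rw [Submodule.span_mul_span, Set.singleton_mul_singleton]
  have A1 : ∀ a d c, r ≤ d → ∃ t : Finset R, t.card ≤ a * bet n 1 r ∧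
      span ℝ (Set.range e) ^ (d+a+1) * span ℝ (Set.range e') ^ (c+1) ≤
        PP e e' r * (span ℝ (Set.range e) ^ (d+a) * span ℝ (Set.range e') ^ c)
        + span ℝ {∏ j ∈ Finset.range a, mom e (r + j)} *
          (span ℝ (Set.range e) ^ (d+1) * span ℝ (Set.range e') ^ (c+1))
        + span ℝ (t : Set R) := by
    intro a
    induction a with
    | zero => 
      intro d c _
      refine ⟨∅, by simp, ?_⟩
      simp only [add_zero, Finset.range_zero, Finset.prod_empty, Submodule.add_eq_sup,
        ← Submodule.one_eq_span, one_mul]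
      exact le_sup_right.trans le_sup_left
    | succ a ih =>
      intro d c hd
      obtain ⟨t1, ht1, h1⟩ := ih (d+1) c (by omega)
      obtain ⟨t2, ht2, h2⟩ := one1 a (d+1) c (by omega)
      refine ⟨t1 ∪ t2.image (fun x => (∏ j ∈ Finset.range a, mom e (r + j)) * x), ?_, ?_⟩
      · refine (Finset.card_union_le _ _).trans ?_
        refine (add_le_add ht1 (Finset.card_image_le.trans ht2)).trans ?_
        rw [add_mul, one_mul]
      · have hm := m1 a
        rw [hsp, Finset.prod_range_succ, hmulspan]
        rw [show d + (a+1) = d + 1 + a by ring]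
        generalize span ℝ {∏ j ∈ Finset.range a, mom e (r + j)} = x at *
        generalize span ℝ {mom e (r+a)} = y at *
        generalize PP e e' r = P at *
        generalize span ℝ (Set.range e) = L1 at *
        generalize span ℝ (Set.range e') = L2 at *
        generalize span ℝ (t1 : Set R) = s1 at *
        generalize span ℝ (t2 : Set R) = s2 at *
        calc _ ≤ _ := h1
          _ ≤ P * (L1 ^ (d+1+a) * L2 ^ c) + x * (y * (L1 ^ (d+1) * L2 ^ (c+1)) +
              P * (L1 ^ (d+1) * L2 ^ c) + s2) + s1 := by gcongr
          _ = P * (L1 ^ (d+1+a) * L2 ^ c) + x * (P * (L1 ^ (d+1) * L2 ^ c)) +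
              (x * y * (L1 ^ (d+1) * L2 ^ (c+1)) + (s1 + x * s2)) := by ring
          _ ≤ P * (L1 ^ (d+1+a) * L2 ^ c) + L1 ^ a * (P * (L1 ^ (d+1) * L2 ^ c)) +
              (x * y * (L1 ^ (d+1) * L2 ^ (c+1)) + (s1 + x * s2)) := by gcongr
          _ = P * (L1 ^ (d+1+a) * L2 ^ c) + P * (L1 ^ (d+1+a) * L2 ^ c) +
              (x * y * (L1 ^ (d+1) * L2 ^ (c+1)) + (s1 + x * s2)) := by ring
          _ = _ := by rw [add_idem]; ring
  revert c
  induction b with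
  | zero =>
    intro c
    simpa using A1 k d c hd
  | succ a ih =>
    intro c
    obtain ⟨t1, ht1, h1⟩ := ih (c+1)
    obtain ⟨t2, ht2, h2⟩ := one2 a d (c+1) (by omega)
    refine ⟨t1 ∪ t2.image (fun x => ((∏ j ∈ Finset.range k, mom e (r + j)) *
      (∏ j ∈ Finset.range a, mom e' (r + j))) * x), ?_, ?_⟩
    · refine (Finset.card_union_le _ _).trans ?_
      refine (add_le_add ht1 (Finset.card_image_le.trans ht2)).trans ?_
      rw [add_mul, one_mul, add_assoc]
    · have hm := m1 k
      have hm' := m2 a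
      rw [hsp, Finset.prod_range_succ, hmulspan, hmulspan, hmulspan]
      rw [hmulspan] at h1
      rw [show c + (a+1) = c + 1 + a by ring]
      generalize span ℝ {∏ j ∈ Finset.range k, mom e (r + j)} = x at *
      generalize span ℝ {∏ j ∈ Finset.range a, mom e' (r + j)} = z at *
      generalize span ℝ {mom e' (r+a)} = y at *
      generalize PP e e' r = P at *
      generalize span ℝ (Set.range e) = L1 at *
      generalize span ℝ (Set.range e') = L2 at *
      generalize span ℝ (t1 : Set R) = s1 at *
      generalize span ℝ (t2 : Set R) = s2 at *
      calc _ ≤ _ := h1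
        _ ≤ P * (L1 ^ (d+k) * L2 ^ (c+1+a)) + x * z * (y * (L1 ^ (d+1) * L2 ^ (c+1)) +
            P * (L1 ^ d * L2 ^ (c+1)) + s2) + s1 := by gcongr
        _ = P * (L1 ^ (d+k) * L2 ^ (c+1+a)) + x * z * (P * (L1 ^ d * L2 ^ (c+1))) +
            (x * z * y * (L1 ^ (d+1) * L2 ^ (c+1)) + (s1 + x * z * s2)) := by ring
        _ ≤ P * (L1 ^ (d+k) * L2 ^ (c+1+a)) + L1 ^ k * L2 ^ a * (P * (L1 ^ d * L2 ^ (c+1))) +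
            (x * z * y * (L1 ^ (d+1) * L2 ^ (c+1)) + (s1 + x * z * s2)) := by gcongr
        _ = P * (L1 ^ (d+k) * L2 ^ (c+1+a)) + P * (L1 ^ (d+k) * L2 ^ (c+1+a)) +
            (x * z * y * (L1 ^ (d+1) * L2 ^ (c+1)) + (s1 + x * z * s2)) := by ring
        _ = _ := by rw [add_idem]; ring

/-- generic perturbation -/
lemma perturb {ι : Type*} [Fintype ι] (W : Submodule ℝ R) (hW : W.FG) (U : ι → Submodule ℝ R)
    (f p : ι → R) (s : Submodule ℝ R)
    (hf : ∀ i, ∀ y ∈ U i, f i * y ∈ W)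
    (hp : ∀ w ∈ W, ∃ y : ι → R, (∀ i, y i ∈ U i) ∧ w - ∑ i, p i * y i ∈ s) :
    ∃ F : Set ℝ, F.Finite ∧ ∀ ε ∉ F, ∀ w ∈ W, ∃ y : ι → R,
      w - ∑ i, (f i + ε • p i) * y i ∈ s := by
  have : Module.Finite ℝ W := Module.Finite.iff_fg.mpr hW
  -- linear section
  let T : ((i : ι) → U i) × s →ₗ[ℝ] R :=
    { toFun := fun z => ∑ i, p i * (z.1 i : R) + z.2
      map_add' := by
        intro a b; simp [mul_add, Finset.sum_add_distrib]; ring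
      map_smul' := by
        intro a b; simp [Finset.smul_sum] }
  have hT : ∀ w : W, (w : R) ∈ LinearMap.range T := by
    rintro ⟨w, hw⟩
    obtain ⟨y, hy, h⟩ := hp w hw
    exact ⟨(fun i => ⟨y i, hy i⟩, ⟨_, h⟩), by simp [T]⟩
  obtain ⟨S, hS⟩ := Module.projective_lifting_property T.rangeRestrict
    (W.subtype.codRestrict (LinearMap.range T) hT) T.surjective_rangeRestrict
  have hS' : ∀ w : W, ∑ i, p i * ((S w).1 i : R) + (S w).2 = w := by
    intro w
    have := congrArg Subtype.val (LinearMap.congr_fun hS w)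
    exact this
  let C : W →ₗ[ℝ] W :=
    { toFun := fun w => ⟨∑ i, f i * ((S w).1 i : R),
        Submodule.sum_mem _ fun i _ => hf i _ ((S w).1 i).2⟩
      map_add' := by
        intro a b; ext; simp [mul_add, Finset.sum_add_distrib]
      map_smul' := by
        intro a b; ext; simp [Finset.smul_sum] }
  refine ⟨{0} ∪ Neg.neg ⁻¹' (spectrum ℝ (C : Module.End ℝ W)), ?_, ?_⟩
  · exact (Set.finite_singleton _).union ((Module.End.finite_spectrum _).preimage neg_injective.injOn)
  · intro ε hε w hw
    simp only [Set.mem_union, Set.mem_singleton_iff, Set.mem_preimage, not_or] at hε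
    obtain ⟨hε0, hε⟩ := hε
    rw [spectrum.notMem_iff] at hε
    have hu := (Module.End.isUnit_iff _).mp hε
    obtain ⟨w', hw'⟩ := hu.2 ⟨-w, W.neg_mem hw⟩
    refine ⟨fun i => (S w').1 i, ?_⟩
    have h1 := congrArg Subtype.val hw'
    simp [C, Module.algebraMap_end_apply] at h1
    have h2 := hS' w'
    have : w - ∑ i, (f i + ε • p i) * ((S w').1 i : R) = ε • ((S w').2 : R) := by
      simp only [add_mul, Finset.sum_add_distrib, smul_mul_assoc, ← Finset.smul_sum]
      rw [← h2] at h1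
      rw [smul_add] at h1
      linear_combination h1
    rw [this]
    exact s.smul_mem _ (S w').2.2
end alg

section fns
variable {n k : ℕ}

abbrev XX (n k : ℕ) := (Fin n → ℝ) × (Fin k → ℝ)

def e1 (n k : ℕ) : Fin (n+1) → (XX n k → ℝ) := Fin.cons 1 fun j z => z.1 j
def e2 (n k : ℕ) : Fin (k+1) → (XX n k → ℝ) := Fin.cons 1 fun j z => z.2 j
def L1 (n k : ℕ) : Submodule ℝ (XX n k → ℝ) := span ℝ (Set.range (e1 n k))
def L2 (n k : ℕ) : Submodule ℝ (XX n k → ℝ) := span ℝ (Set.range (e2 n k))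

lemma one_mem_L1 : (1 : XX n k → ℝ) ∈ L1 n k := subset_span ⟨0, rfl⟩
lemma one_mem_L2 : (1 : XX n k → ℝ) ∈ L2 n k := subset_span ⟨0, rfl⟩
lemma x_mem_L1 (j : Fin n) : (fun z => z.1 j : XX n k → ℝ) ∈ L1 n k :=
  subset_span ⟨j.succ, by simp [e1]⟩
lemma x_mem_L2 (j : Fin k) : (fun z => z.2 j : XX n k → ℝ) ∈ L2 n k :=
  subset_span ⟨j.succ, by simp [e2]⟩
lemma one_le_L1 : 1 ≤ L1 n k := Submodule.one_le.mpr one_mem_L1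
lemma one_le_L2 : 1 ≤ L2 n k := Submodule.one_le.mpr one_mem_L2

lemma sep (p q : XX n k) (h : p ≠ q) : ∃ f ∈ L1 n k * L2 n k, f p ≠ 0 ∧ f q = 0 := by
  by_cases h1 : p.1 = q.1
  · have h2 : p.2 ≠ q.2 := fun h2 => h (Prod.ext h1 h2)
    obtain ⟨j, hj⟩ := Function.ne_iff.mp h2
    refine ⟨1 * ((fun z => z.2 j) - (q.2 j) • 1), Submodule.mul_mem_mul one_mem_L1
      (Submodule.sub_mem _ (x_mem_L2 j) (Submodule.smul_mem _ _ one_mem_L2)), ?_, ?_⟩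
    · simpa [sub_eq_zero] using hj
    · simp
  · obtain ⟨j, hj⟩ := Function.ne_iff.mp h1
    refine ⟨((fun z => z.1 j) - (q.1 j) • 1) * 1, Submodule.mul_mem_mul 
      (Submodule.sub_mem _ (x_mem_L1 j) (Submodule.smul_mem _ _ one_mem_L1)) one_mem_L2, ?_, ?_⟩
    · simpa [sub_eq_zero] using hj
    · simp

lemma prod_mem_pow' {R : Type*} [CommRing R] [Algebra ℝ R] (L : Submodule ℝ R) {ι : Type*}
    (s : Finset ι) (f : ι → R) (h : ∀ i ∈ s, f i ∈ L) : ∏ i ∈ s, f i ∈ L ^ s.card := by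
  classical
  induction s using Finset.induction_on with
  | empty => simp [Submodule.one_le.mp le_rfl]
  | insert a s ha ih =>
    rw [Finset.prod_insert ha, Finset.card_insert_of_notMem ha, pow_succ']
    exact Submodule.mul_mem_mul (h a (by simp)) (ih fun i hi => h i (by simp [hi]))

lemma interp {N : ℕ} (pts : Fin N → XX n k) (hinj : Function.Injective pts) (D E : ℕ)
    (hD : N ≤ D) (hE : N ≤ E) (i : Fin N) :
    ∃ q ∈ L1 n k ^ D * L2 n k ^ E, ∀ j, q (pts j) = if j = i then 1 else 0 := by
  classical
  have : ∀ j, ∃ f ∈ L1 n k * L2 n k, j ≠ i → f (pts i) ≠ 0 ∧ f (pts j) = 0 := by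
    intro j
    by_cases h : j = i
    · exact ⟨0, Submodule.zero_mem _, fun h' => absurd h h'⟩
    · obtain ⟨f, hf, h1⟩ := sep (pts i) (pts j) (fun h' => h (hinj h').symm)
      exact ⟨f, hf, fun _ => h1⟩
  choose f hf hf' using this
  set q := ∏ j ∈ Finset.univ.erase i, f j with hq
  have hqi : q (pts i) ≠ 0 := by
    rw [hq, Finset.prod_apply, Finset.prod_ne_zero_iff]
    intro j hj
    exact (hf' j (Finset.ne_of_mem_erase hj)).1
  refine ⟨(q (pts i))⁻¹ • q, Submodule.smul_mem _ _ ?_, ?_⟩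
  · have h1 := prod_mem_pow' _ (Finset.univ.erase i) f (fun j _ => hf j)
    rw [mul_pow] at h1
    have hc : (Finset.univ.erase i).card ≤ N := by
      refine (Finset.card_le_univ _).trans (by simp)
    have a1 := one_le_L1 (n := n) (k := k)
    have a2 := one_le_L2 (n := n) (k := k)
    have hle : L1 n k ^ (Finset.univ.erase i).card * L2 n k ^ (Finset.univ.erase i).card ≤
        L1 n k ^ D * L2 n k ^ E := by
      gcongr
      · exact hc.trans hD
      · exact hc.trans hE
    exact hle h1
  · intro j
    split_ifs with h
    · subst h; simp [hqi]
    · have : q (pts j) = 0 := by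
        rw [hq, Finset.prod_apply, Finset.prod_eq_zero_iff]
        exact ⟨j, by simp [h], (hf' j h).2⟩
      simp [this]

/-- the perturbations -/
noncomputable def pp (n k : ℕ) (i : ℕ) : XX n k → ℝ := mom (e1 n k) i * mom (e2 n k) i
noncomputable def hh (n k : ℕ) (r : ℕ) : XX n k → ℝ := 
  (∏ j ∈ Finset.range k, mom (e1 n k) (r + j)) * ∏ j ∈ Finset.range n, mom (e2 n k) (r + j)

lemma bez {r : ℕ} (hr : r + 1 = n + k) (f : Fin r → XX n k → ℝ) (g : XX n k → ℝ)
    (hf : ∀ i, f i ∈ L1 n k * L2 n k) (hg : g ∈ L1 n k ^ k * L2 n k ^ n) (N : ℕ)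
    (hN : k * bet n 1 r + n * bet n 0 r < N) :
    ∃ F : Set ℝ, F.Finite ∧ ∀ ε ∉ F, ∀ pts : Fin N → XX n k, Function.Injective pts →
      ¬ (∀ j, (∀ i, f i (pts j) + ε * pp n k i (pts j) = 0) ∧
        g (pts j) + ε * hh n k r (pts j) = 0) := by
  classical
  obtain ⟨h, hh', t, ht, hcov⟩ := cover (e1 n k) (e2 n k) (N + r) N r hr (by omega) n
  change L1 n k ^ (N + r + k + 1) * L2 n k ^ (N + n + 1) ≤ _ * (L1 n k ^ (N + r + k) * L2 n k ^ (N + n))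
    + span ℝ {h} * (L1 n k ^ (N + r + 1) * L2 n k ^ (N + 1)) + _ at hcov
  replace hh' : h = hh n k r := hh'
  subst hh'
  set W := L1 n k ^ (N + r + k + 1) * L2 n k ^ (N + n + 1) with hWdef
  have fg1 : (L1 n k).FG := ⟨Finset.univ.image (e1 n k), by simp [L1]⟩
  have fg2 : (L2 n k).FG := ⟨Finset.univ.image (e2 n k), by simp [L2]⟩
  have hW : W.FG := (fg1.pow _).mul (fg2.pow _)
  obtain ⟨F, hF, hP⟩ := perturb (ι := Option (Fin r)) W hW
    (fun o => o.elim (L1 n k ^ (N + r + 1) * L2 n k ^ (N + 1))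
      (fun _ => L1 n k ^ (N + r + k) * L2 n k ^ (N + n)))
    (fun o => o.elim g f) (fun o => o.elim (hh n k r) (fun i => pp n k i)) (span ℝ (t : Set _))
    (by
      rintro (_ | i) y hy
      · have := Submodule.mul_mem_mul hg hy
        have hE : L1 n k ^ k * L2 n k ^ n * (L1 n k ^ (N + r + 1) * L2 n k ^ (N + 1)) = W := by
          rw [hWdef]; ring
        exact hE.le this
      · have := Submodule.mul_mem_mul (hf i) hy
        have hE : L1 n k * L2 n k * (L1 n k ^ (N + r + k) * L2 n k ^ (N + n)) = W := by
          rw [hWdef]; ring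
        exact hE.le this)
    (by
      intro w hw
      have h1 := hcov hw
      rw [Submodule.add_eq_sup, Submodule.add_eq_sup, Submodule.mem_sup] at h1
      obtain ⟨a, ha, b, hb, rfl⟩ := h1
      rw [Submodule.mem_sup] at ha
      obtain ⟨a, ha, c, hc, rfl⟩ := ha
      rw [Submodule.mem_span_singleton_mul] at hc
      obtain ⟨v, hv, rfl⟩ := hc
      have hy : ∀ a ∈ PP (e1 n k) (e2 n k) r * (L1 n k ^ (N + r + k) * L2 n k ^ (N + n)),
          ∃ y : Fin r → (XX n k → ℝ), (∀ i, y i ∈ (L1 n k ^ (N + r + k) * L2 n k ^ (N + n))) ∧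
            a = ∑ i : Fin r, pp n k i * y i := by
        intro a ha
        refine Submodule.mul_induction_on ha ?_ ?_
        · intro m hm u hu
          unfold PP at hm
          induction hm using Submodule.span_induction with
          | mem x hx =>
            obtain ⟨i, hi, rfl⟩ := hx
            have hi : i < r := by simpa using hi
            refine ⟨Pi.single ⟨i, hi⟩ u, ?_, ?_⟩
            · intro j
              by_cases hj : j = ⟨i, hi⟩
              · subst hj; simpa using hu
              · rw [Pi.single_eq_of_ne hj]; exact Submodule.zero_mem _
            · rw [Finset.sum_eq_single ⟨i, hi⟩]
              · simp [pp]
              · intro j _ hj; rw [Pi.single_eq_of_ne hj, mul_zero]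
              · simp
          | zero => exact ⟨0, fun i => Submodule.zero_mem _, by simp⟩
          | add x y _ _ hx hy =>
            obtain ⟨a, ha, ha'⟩ := hx
            obtain ⟨b, hb, hb'⟩ := hy
            refine ⟨a + b, fun i => Submodule.add_mem _ (ha i) (hb i), ?_⟩
            rw [add_mul, ha', hb', ← Finset.sum_add_distrib]
            simp [mul_add]
          | smul c x _ hx =>
            obtain ⟨a, ha, ha'⟩ := hx
            refine ⟨c • a, fun i => Submodule.smul_mem _ _ (ha i), ?_⟩
            rw [smul_mul_assoc, ha', Finset.smul_sum]
            simp
        · rintro _ _ ⟨a, ha, rfl⟩ ⟨b, hb, rfl⟩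
          refine ⟨a + b, fun i => Submodule.add_mem _ (ha i) (hb i), ?_⟩
          rw [← Finset.sum_add_distrib]
          simp [mul_add]
      obtain ⟨y, hy, rfl⟩ := hy a ha
      refine ⟨fun o => o.elim v y, ?_, ?_⟩
      · rintro (_ | i)
        · exact hv
        · exact hy i
      · convert hb using 1
        rw [Fintype.sum_option]
        dsimp only [Option.elim]
        ring)
  refine ⟨F, hF, ?_⟩
  intro ε hε pts hinj hz
  have hP := hP ε hε
  let ev : (XX n k → ℝ) →ₗ[ℝ] (Fin N → ℝ) := LinearMap.funLeft ℝ ℝ pts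
  have htop : (span ℝ (t : Set (XX n k → ℝ))).map ev = ⊤ := by
    rw [eq_top_iff, ← (Pi.basisFun ℝ (Fin N)).span_eq, Submodule.span_le]
    rintro _ ⟨i, rfl⟩
    obtain ⟨q, hq, hq'⟩ := interp pts hinj (N + r + k + 1) (N + n + 1) (by omega) (by omega) i
    obtain ⟨y, hy⟩ := hP q hq
    refine ⟨_, hy, ?_⟩
    ext j
    have h1 : (∑ i : Option (Fin r), ((i.elim g f : XX n k → ℝ) + 
        ε • (i.elim (hh n k r) (fun i => pp n k i) : XX n k → ℝ)) * y i) (pts j) = 0 := by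
      rw [Finset.sum_apply]
      refine Finset.sum_eq_zero ?_
      rintro (_ | i) _
      · simp [(hz j).2]
      · simp [(hz j).1 i]
    simp only [ev, LinearMap.funLeft_apply, Pi.sub_apply, h1, hq', Pi.basisFun_apply, Pi.single_apply]
    simp
  have h2 : (span ℝ (t : Set (XX n k → ℝ))).map ev = span ℝ ((t.image ev : Finset _) : Set _) := by
    rw [Submodule.map_span, Finset.coe_image]
  have h3 := finrank_span_finset_le_card (R := ℝ) (t.image ev)
  rw [Set.finrank, ← h2, htop, finrank_top] at h3
  have h4 := Finset.card_image_le (s := t) (f := ev)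
  simp at h3
  omega
end fns

section analysis

lemma persist {E F : Type*} [NormedAddCommGroup E] [NormedSpace ℝ E] [CompleteSpace E]
    [NormedAddCommGroup F] [NormedSpace ℝ F] [CompleteSpace F] (Φ P : E → F) (z0 : E)
    (Φ' P' : E →L[ℝ] F) (hΦ : HasStrictFDerivAt Φ Φ' z0) (hP : HasStrictFDerivAt P P' z0)
    (hs : Function.Surjective Φ') (h0 : Φ z0 = 0) (U : Set E) (hU : U ∈ nhds z0) :
    ∀ᶠ ε in nhds (0:ℝ), ∃ z ∈ U, Φ z + ε • P z = 0 := by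
  have h1 : HasStrictFDerivAt (fun q : ℝ × E => Φ q.2) (Φ'.comp (ContinuousLinearMap.snd ℝ ℝ E)) (0, z0) :=
    HasStrictFDerivAt.comp (0, z0) (f := fun q : ℝ × E => q.2) hΦ hasStrictFDerivAt_snd
  have h2 : HasStrictFDerivAt (fun q : ℝ × E => P q.2) (P'.comp (ContinuousLinearMap.snd ℝ ℝ E)) (0, z0) :=
    HasStrictFDerivAt.comp (0, z0) (f := fun q : ℝ × E => q.2) hP hasStrictFDerivAt_snd
  have h3 : HasStrictFDerivAt (fun q : ℝ × E => q.1) (ContinuousLinearMap.fst ℝ ℝ E) (0, z0) :=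
    hasStrictFDerivAt_fst
  have h4 := h3.prodMk (h1.add (h3.smul h2))
  have hG := h4.map_nhds_eq_of_surj (by
    rw [LinearMap.range_eq_top]
    rintro ⟨a, b⟩
    obtain ⟨z, hz⟩ := hs (b - a • P z0)
    refine ⟨(a, z), ?_⟩
    simp [hz])
  have hmem : (Set.univ : Set ℝ) ×ˢ U ∈ nhds ((0:ℝ), z0) := by
    rw [nhds_prod_eq]; exact Filter.prod_mem_prod Filter.univ_mem hU
  have himg := Filter.image_mem_map (m := fun q : ℝ × E => (q.1, Φ q.2 + q.1 • P q.2)) hmem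
  have hG' : Filter.map (fun q : ℝ × E => (q.1, Φ q.2 + q.1 • P q.2)) (nhds (0, z0))
      = nhds ((0:ℝ), (0:F)) := by
    have := hG
    simp only [Pi.add_apply, Pi.smul_apply', h0, zero_smul, add_zero] at this
    exact this
  rw [hG'] at himg
  have hc : Filter.Tendsto (fun ε : ℝ => (ε, (0:F))) (nhds 0) (nhds (0, 0)) := by
    apply Continuous.tendsto'
    · fun_prop
    · rfl
  filter_upwards [hc himg] with ε hε
  obtain ⟨⟨a, z⟩, ⟨-, hz⟩, h⟩ := hε
  simp only [Prod.mk.injEq] at h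
  obtain ⟨rfl, h⟩ := h
  exact ⟨z, hz, h⟩

lemma mom_e1_contDiff {n k : ℕ} (t : ℕ) : ContDiff ℝ 1 (mom (e1 n k) t) := by
  have : mom (e1 n k) t = fun z => ∑ j : Fin (n+1), (t:ℝ)^(j:ℕ) * e1 n k j z := by
    ext z; simp [mom]
  rw [this]
  refine ContDiff.sum fun j _ => contDiff_const.mul ?_
  refine Fin.cases ?_ (fun j => ?_) j
  · exact contDiff_const
  · change ContDiff ℝ 1 (fun z : XX n k => z.1 j)
    fun_prop

lemma mom_e2_contDiff {n k : ℕ} (t : ℕ) : ContDiff ℝ 1 (mom (e2 n k) t) := by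
  have : mom (e2 n k) t = fun z => ∑ j : Fin (k+1), (t:ℝ)^(j:ℕ) * e2 n k j z := by
    ext z; simp [mom]
  rw [this]
  refine ContDiff.sum fun j _ => contDiff_const.mul ?_
  refine Fin.cases ?_ (fun j => ?_) j
  · exact contDiff_const
  · change ContDiff ℝ 1 (fun z : XX n k => z.2 j)
    fun_prop

lemma pp_contDiff {n k : ℕ} (t : ℕ) : ContDiff ℝ 1 (pp n k t) :=
  (mom_e1_contDiff t).mul (mom_e2_contDiff t)

lemma hh_contDiff {n k : ℕ} (r : ℕ) : ContDiff ℝ 1 (hh n k r) := by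
  have : hh n k r = fun z => (∏ j ∈ Finset.range k, mom (e1 n k) (r + j) z) *
      ∏ j ∈ Finset.range n, mom (e2 n k) (r + j) z := by
    ext z; simp [hh, Finset.prod_apply]
  rw [this]
  exact (contDiff_prod fun j _ => mom_e1_contDiff _).mul (contDiff_prod fun j _ => mom_e2_contDiff _)

lemma cpPhi_contDiff {m n : ℕ} (A : Matrix (Fin m) (Fin n) ℝ)
    (b : Fin m → ℝ) (c : Fin n → ℝ) (u : Fin n → ℝ) (v w : Fin m → ℝ) :
    ContDiff ℝ 1 (cpPhi A b c u v w) := by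
  have : ∀ {p q : ℕ} (B : Matrix (Fin p) (Fin q) ℝ), ContDiff ℝ 1 B.mulVec := fun B =>
    (LinearMap.toContinuousLinearMap B.mulVecLin).contDiff
  have h1 := this A
  have h2 := this A.transpose
  unfold cpPhi
  fun_prop
end analysis

section matrixpart
variable {n k : ℕ} (A : Matrix (Fin (n+k)) (Fin n) ℝ) (b y0 : Fin (n+k) → ℝ)
  (K : Matrix (Fin (n+k)) (Fin k) ℝ)

def sF (i : Fin (n+k)) : XX n k → ℝ := fun z => A.mulVec z.1 i - b i
def yF (i : Fin (n+k)) : XX n k → ℝ := fun z => y0 i + K.mulVec z.2 i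

def Mz (z : XX n k) : Matrix (Fin n ⊕ Fin k) (Fin n ⊕ Fin k) ℝ := fun i c =>
  Sum.elim (fun j => A (finSumFinEquiv i) j * yF y0 K (finSumFinEquiv i) z)
    (fun l => K (finSumFinEquiv i) l * sF A b (finSumFinEquiv i) z) c

def gg (rho : Fin n ⊕ Fin k → ℝ) (z : XX n k) : ℝ :=
  ∑ c, rho c * ((Mz A b y0 K z).updateCol c 1).det

lemma sF_mem (i : Fin (n+k)) : sF A b i ∈ L1 n k := by
  have : sF A b i = ∑ j, A i j • (fun z => z.1 j : XX n k → ℝ) - b i • 1 := by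
    ext z; simp [sF, Matrix.mulVec, dotProduct]
  rw [this]
  exact Submodule.sub_mem _ (Submodule.sum_mem _ fun j _ => Submodule.smul_mem _ _ (x_mem_L1 j))
    (Submodule.smul_mem _ _ one_mem_L1)

lemma yF_mem (i : Fin (n+k)) : yF y0 K i ∈ L2 n k := by
  have : yF y0 K i = y0 i • 1 + ∑ j, K i j • (fun z => z.2 j : XX n k → ℝ) := by
    ext z; simp [yF, Matrix.mulVec, dotProduct]
  rw [this]
  exact Submodule.add_mem _ (Submodule.smul_mem _ _ one_mem_L2)
    (Submodule.sum_mem _ fun j _ => Submodule.smul_mem _ _ (x_mem_L2 j))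

lemma det_mem (N : XX n k → Matrix (Fin n ⊕ Fin k) (Fin n ⊕ Fin k) ℝ)
    (h1 : ∀ i j, (fun z => N z i (Sum.inl j)) ∈ L2 n k)
    (h2 : ∀ i j, (fun z => N z i (Sum.inr j)) ∈ L1 n k) :
    (fun z => (N z).det) ∈ L1 n k ^ k * L2 n k ^ n := by
  have : (fun z => (N z).det) = ∑ σ : Equiv.Perm (Fin n ⊕ Fin k), ((Equiv.Perm.sign σ : ℤ) : ℝ) •
      ((∏ j : Fin k, fun z => N z (σ (Sum.inr j)) (Sum.inr j)) *
        ∏ j : Fin n, fun z => N z (σ (Sum.inl j)) (Sum.inl j)) := by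
    ext z
    simp only [Matrix.det_apply', Fintype.prod_sum_type, Finset.sum_apply, Pi.smul_apply,
      Pi.mul_apply, Finset.prod_apply, smul_eq_mul]
    refine Finset.sum_congr rfl fun σ _ => ?_
    ring
  rw [this]
  refine Submodule.sum_mem _ fun σ _ => Submodule.smul_mem _ _ (Submodule.mul_mem_mul ?_ ?_)
  · simpa using prod_mem_pow' (L1 n k) Finset.univ _ fun j _ => h2 (σ (Sum.inr j)) j
  · simpa using prod_mem_pow' (L2 n k) Finset.univ _ fun j _ => h1 (σ (Sum.inl j)) j

lemma gg_mem (rho : Fin n ⊕ Fin k → ℝ) : gg A b y0 K rho ∈ L1 n k ^ k * L2 n k ^ n := by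
  have : gg A b y0 K rho = ∑ c, rho c • fun z => ((Mz A b y0 K z).updateCol c 1).det := by
    ext z; simp [gg]
  rw [this]
  refine Submodule.sum_mem _ fun c _ => Submodule.smul_mem _ _ (det_mem _ ?_ ?_)
  · intro i j
    by_cases h : Sum.inl j = c
    · subst h
      simp only [Matrix.updateCol_self]
      exact one_mem_L2
    · simp only [Matrix.updateCol_ne h]
      have := Submodule.smul_mem _ (A (finSumFinEquiv i) j) (yF_mem y0 K (finSumFinEquiv i))
      exact this
  · intro i j
    by_cases h : Sum.inr j = c
    · subst h
      simp only [Matrix.updateCol_self]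
      exact one_mem_L1
    · simp only [Matrix.updateCol_ne h]
      have := Submodule.smul_mem _ (K (finSumFinEquiv i) j) (sF_mem A b (finSumFinEquiv i))
      exact this

lemma det_contDiff : ContDiff ℝ 1 (fun z => (Mz A b y0 K z).det) := by
  have h1 : ∀ i, ContDiff ℝ 1 (sF A b i) := fun i => by
    unfold sF Matrix.mulVec dotProduct; fun_prop
  have h2 : ∀ i, ContDiff ℝ 1 (yF y0 K i) := fun i => by
    unfold yF Matrix.mulVec dotProduct; fun_prop
  simp only [Matrix.det_apply']
  refine ContDiff.sum fun σ _ => contDiff_const.mul (contDiff_prod fun i _ => ?_)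
  rcases i with j | j
  · exact contDiff_const.mul (h2 _)
  · exact contDiff_const.mul (h1 _)

lemma cramer_pt (z : XX n k) (ξ : Fin n ⊕ Fin k → ℝ) (h : (Mz A b y0 K z).mulVec ξ = 1)
    (c : Fin n ⊕ Fin k) :
    ((Mz A b y0 K z).updateCol c 1).det = (Mz A b y0 K z).det * ξ c := by
  rw [← Matrix.cramer_apply, ← h, Matrix.cramer_eq_adjugate_mulVec, Matrix.mulVec_mulVec,
    Matrix.adjugate_mul]
  simp [Matrix.smul_mulVec]

lemma Mz_mulVec (z : XX n k) (α : Fin n → ℝ) (ζ : Fin k → ℝ) (i : Fin n ⊕ Fin k) :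
    (Mz A b y0 K z).mulVec (Sum.elim α ζ) i =
      A.mulVec α (finSumFinEquiv i) * yF y0 K (finSumFinEquiv i) z
      + sF A b (finSumFinEquiv i) z * K.mulVec ζ (finSumFinEquiv i) := by
  simp only [Matrix.mulVec, dotProduct, Mz, Fintype.sum_sum_type, Sum.elim_inl, Sum.elim_inr,
    Finset.sum_mul, Finset.mul_sum]
  congr 1 <;> exact Finset.sum_congr rfl fun _ _ => by ring

lemma det_ne (z : XX n k) (μ : ℝ) (hμ : 0 < μ) (h : ∀ i, sF A b i z * yF y0 K i z = μ)
    (hAK : ∀ ζ, A.transpose.mulVec (K.mulVec ζ) = 0) (hA : Function.Injective A.mulVec)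
    (hK : Function.Injective K.mulVec) : (Mz A b y0 K z).det ≠ 0 := by
  intro hdet
  obtain ⟨ξ, hξ, h0⟩ := Matrix.exists_mulVec_eq_zero_iff.mpr hdet
  obtain ⟨α, ζ, rfl⟩ : ∃ α ζ, ξ = Sum.elim α ζ := ⟨ξ ∘ Sum.inl, ξ ∘ Sum.inr, by simp⟩
  have h1 : ∀ i, A.mulVec α i * yF y0 K i z + sF A b i z * K.mulVec ζ i = 0 := by
    intro i
    have := congrFun h0 (finSumFinEquiv.symm i)
    rw [Mz_mulVec] at this
    simpa using this
  have h2 : ∑ i, A.mulVec α i * K.mulVec ζ i = 0 := by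
    have : A.mulVec α ⬝ᵥ K.mulVec ζ = 0 := by
      rw [← Matrix.vecMul_transpose, ← Matrix.dotProduct_mulVec, hAK, dotProduct_zero]
    exact this
  have h3 : ∑ i, (sF A b i z * K.mulVec ζ i) ^ 2 = 0 := by
    have : ∀ i, (sF A b i z * K.mulVec ζ i) ^ 2 = - μ * (A.mulVec α i * K.mulVec ζ i) := by
      intro i
      rw [← h i]
      linear_combination (sF A b i z * K.mulVec ζ i) * h1 i
    simp_rw [this, ← Finset.mul_sum, h2, mul_zero]
  have h4 := (Finset.sum_eq_zero_iff_of_nonneg (fun i _ => sq_nonneg _)).mp h3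
  have hs : ∀ i, sF A b i z ≠ 0 := fun i hi => by have := h i; rw [hi] at this; linarith
  have hy : ∀ i, yF y0 K i z ≠ 0 := fun i hi => by have := h i; rw [hi] at this; linarith
  have h5 : K.mulVec ζ = 0 := by
    ext i
    have := pow_eq_zero_iff (two_ne_zero) |>.mp (h4 i (Finset.mem_univ _))
    exact (mul_eq_zero.mp this).resolve_left (hs i)
  have h6 : A.mulVec α = 0 := by
    ext i
    have := h1 i
    rw [h5] at this
    simp at this
    exact this.resolve_right (hy i)
  have h7 : ζ = 0 := hK (by simp [h5])
  have h8 : α = 0 := hA (by simp [h6])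
  apply hξ
  subst h7 h8
  ext (i | i) <;> simp

end matrixpart

section final

lemma exists_K {n k : ℕ} (A : Matrix (Fin (n+k)) (Fin n) ℝ) (hA : A.rank = n) :
    ∃ (K : Matrix (Fin (n+k)) (Fin k) ℝ) (π : (Fin (n+k) → ℝ) →ₗ[ℝ] (Fin k → ℝ)),
      (∀ ζ, A.transpose.mulVec (K.mulVec ζ) = 0) ∧ Function.Injective K.mulVec ∧
      ∀ y, A.transpose.mulVec y = 0 → K.mulVec (π y) = y := by
  have hfr : Module.finrank ℝ (LinearMap.ker A.transpose.mulVecLin) = k := by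
    have h1 := LinearMap.finrank_range_add_finrank_ker A.transpose.mulVecLin
    have h2 : Module.finrank ℝ (LinearMap.range A.transpose.mulVecLin) = n := by
      have h3 : A.transpose.rank = n := by rw [Matrix.rank_transpose, hA]
      exact h3
    rw [h2] at h1
    simp at h1
    exact h1
  let bs := Module.finBasisOfFinrankEq ℝ _ hfr
  let κ : (Fin k → ℝ) →ₗ[ℝ] (Fin (n+k) → ℝ) :=
    (LinearMap.ker A.transpose.mulVecLin).subtype ∘ₗ bs.equivFun.symm.toLinearMap
  have hinj : Function.Injective κ := by
    intro a b h
    exact bs.equivFun.symm.injective (Subtype.ext h)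
  have hKκ : ∀ ζ, (LinearMap.toMatrix' κ).mulVec ζ = κ ζ := fun ζ => LinearMap.toMatrix'_mulVec κ ζ
  obtain ⟨π, hπ⟩ := LinearMap.exists_leftInverse_of_injective κ (LinearMap.ker_eq_bot.mpr hinj)
  refine ⟨LinearMap.toMatrix' κ, π, ?_, ?_, ?_⟩
  · intro ζ
    rw [hKκ]
    exact (bs.equivFun.symm ζ).2
  · intro a b h
    rw [hKκ, hKκ] at h
    exact hinj h
  · intro y hy
    obtain ⟨ζ, hζ⟩ := bs.equivFun.symm.surjective ⟨y, hy⟩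
    have : κ ζ = y := congrArg Subtype.val hζ
    rw [hKκ, ← this]
    have h2 := LinearMap.congr_fun hπ ζ
    simp only [LinearMap.comp_apply, LinearMap.id_apply] at h2
    rw [h2]

lemma count_eq (n k : ℕ) (hn : 1 ≤ n) (hk : 1 ≤ k) :
    k * bet n 1 (n+k-1) + n * bet n 0 (n+k-1) = 2 * n * (n+k-1).choose n := by
  obtain ⟨n, rfl⟩ : ∃ n', n = n' + 1 := ⟨n - 1, by omega⟩
  have h := Nat.choose_succ_right_eq (n + 1 + k - 1) n
  rw [show n + 1 + k - 1 - n = k by omega] at h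
  rw [show n + 1 + k - 1 = n + k by omega] at h ⊢
  simp [bet]
  linarith

theorem main (n k : ℕ) (hn : 1 ≤ n) (hk : 1 ≤ k)
    (A : Matrix (Fin (n+k)) (Fin n) ℝ) (hA : A.rank = n)
    (b : Fin (n+k) → ℝ) (c : Fin n → ℝ)
    (u : Fin n → ℝ) (v w : Fin (n+k) → ℝ) :
    Set.encard {z : CPVars ℝ (n+k) n |
        0 < z.2.2.2.2.2.2 ∧ cpPhi A b c u v w z = 0 ∧
        Function.Bijective (fderiv ℝ (cpPhi A b c u v w) z)}
      ≤ ((2 * n * (n + k - 1).choose n : ℕ) : ℕ∞) := by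
  classical
  by_contra hcon
  rw [not_le] at hcon
  set B := 2 * n * (n + k - 1).choose n with hB
  set Sol := {z : CPVars ℝ (n+k) n |
        0 < z.2.2.2.2.2.2 ∧ cpPhi A b c u v w z = 0 ∧
        Function.Bijective (fderiv ℝ (cpPhi A b c u v w) z)} with hSol
  have hcon' : ((B + 1 : ℕ) : ℕ∞) ≤ Sol.encard := by
    push_cast
    exact Order.add_one_le_of_lt hcon
  obtain ⟨t, htS, htc⟩ := Set.exists_subset_encard_eq hcon'
  have htfin : t.Finite := Set.finite_of_encard_eq_coe htc
  have htn : htfin.toFinset.card = B + 1 := by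
    rw [htfin.encard_eq_coe_toFinset_card] at htc
    exact_mod_cast htc
  let zs : Fin (B+1) → CPVars ℝ (n+k) n := fun j => (htfin.toFinset.equivFinOfCardEq htn).symm j
  have hzinj : Function.Injective zs := fun i j h =>
    (htfin.toFinset.equivFinOfCardEq htn).symm.injective (Subtype.ext h)
  have hzS : ∀ j, zs j ∈ Sol := fun j => htS (htfin.mem_toFinset.mp ((htfin.toFinset.equivFinOfCardEq htn).symm j).2)
  clear_value zs
  obtain ⟨K, π, hAK, hKinj, hKπ⟩ := exists_K A hA
  have hAinj : Function.Injective A.mulVec := by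
    have h1 := LinearMap.finrank_range_add_finrank_ker A.mulVecLin
    have h2 : Module.finrank ℝ (LinearMap.range A.mulVecLin) = n := hA
    rw [h2] at h1
    simp at h1
    have := LinearMap.ker_eq_bot.mp h1
    exact this
  -- base point
  set y0 : Fin (n+k) → ℝ := (zs 0).2.2.1 with hy0def
  have hy0 : A.transpose.mulVec y0 = c := by
    have := (hzS 0).2.1
    have := congrArg (fun q => q.2.1) this
    exact sub_eq_zero.mp this
  clear_value y0
  let prj : CPVars ℝ (n+k) n → XX n k := fun z => (z.1, π (z.2.2.1 - y0))
  let rho : Fin n ⊕ Fin k → ℝ := Sum.elim (fun j => u j + ∑ i, v i * A i j) (fun l => ∑ i, w i * K i l)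
  -- structure of solutions
  have struct : ∀ z : CPVars ℝ (n+k) n, A.mulVec z.1 - z.2.1 - b = 0 → 
      A.transpose.mulVec z.2.2.1 - c = 0 → A.mulVec z.2.2.2.1 - z.2.2.2.2.1 = 0 → 
      A.transpose.mulVec z.2.2.2.2.2.1 = 0 → 
      (∀ i, z.2.2.2.2.1 i * z.2.2.1 i + z.2.1 i * z.2.2.2.2.2.1 i - 1 = 0) → 
      (∀ i, z.2.1 i = sF A b i (prj z)) ∧ (∀ i, z.2.2.1 i = yF y0 K i (prj z)) ∧
      z.2.2.2.2.1 = A.mulVec z.2.2.2.1 ∧ K.mulVec (π z.2.2.2.2.2.1) = z.2.2.2.2.2.1 ∧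
      (Mz A b y0 K (prj z)).mulVec (Sum.elim z.2.2.2.1 (π z.2.2.2.2.2.1)) = 1 := by
    intro z E1 E2 E4 E5 E6
    have g1 : ∀ i, z.2.1 i = sF A b i (prj z) := by
      intro i
      have := congrFun E1 i
      simp only [Pi.sub_apply, Pi.zero_apply] at this
      simp only [sF, prj]
      linarith
    have g2 : ∀ i, z.2.2.1 i = yF y0 K i (prj z) := by
      intro i
      have h1 : A.transpose.mulVec (z.2.2.1 - y0) = 0 := by
        rw [Matrix.mulVec_sub, hy0, E2]
      have := congrFun (hKπ _ h1) i
      simp only [yF, prj]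
      rw [this]
      simp
    have g3 : z.2.2.2.2.1 = A.mulVec z.2.2.2.1 := (sub_eq_zero.mp E4).symm
    have g4 := hKπ _ E5
    refine ⟨g1, g2, g3, g4, ?_⟩
    ext i
    rw [Mz_mulVec, ← g1, ← g2, g4, ← g3]
    simpa [sub_eq_zero] using E6 (finSumFinEquiv i)
  have struct0 : ∀ z ∈ Sol, (∀ i, z.2.1 i = sF A b i (prj z)) ∧ (∀ i, z.2.2.1 i = yF y0 K i (prj z)) ∧
      z.2.2.2.2.1 = A.mulVec z.2.2.2.1 ∧ K.mulVec (π z.2.2.2.2.2.1) = z.2.2.2.2.2.1 ∧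
      (Mz A b y0 K (prj z)).mulVec (Sum.elim z.2.2.2.1 (π z.2.2.2.2.2.1)) = 1 ∧
      (∀ i, z.2.1 i * z.2.2.1 i = z.2.2.2.2.2.2) ∧ (Mz A b y0 K (prj z)).det ≠ 0 := by
    intro z hz
    have hΦ := hz.2.1
    simp only [cpPhi, Prod.ext_iff, Prod.fst_zero, Prod.snd_zero] at hΦ
    obtain ⟨E1, E2, E3, E4, E5, E6, E7⟩ := hΦ
    obtain ⟨g1, g2, g3, g4, g5⟩ := struct z E1 E2 E4 E5 (fun i => congrFun E6 i)
    have g6 : ∀ i, z.2.1 i * z.2.2.1 i = z.2.2.2.2.2.2 := fun i => sub_eq_zero.mp (congrFun E3 i)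
    refine ⟨g1, g2, g3, g4, g5, g6, ?_⟩
    refine det_ne A b y0 K (prj z) z.2.2.2.2.2.2 hz.1 ?_ hAK hAinj hKinj
    intro i
    rw [← g1, ← g2, g6]
  -- injectivity of the projection
  have hprj : ∀ z ∈ Sol, ∀ z' ∈ Sol, prj z = prj z' → z = z' := by
    intro z hz z' hz' h
    obtain ⟨g1, g2, g3, g4, g5, g6, g7⟩ := struct0 z hz
    obtain ⟨g1', g2', g3', g4', g5', g6', g7'⟩ := struct0 z' hz'
    have k0 : z.1 = z'.1 := congrArg (fun q : XX n k => q.1) h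
    have k1 : z.2.1 = z'.2.1 := by ext i; rw [g1, g1', h]
    have k2 : z.2.2.1 = z'.2.2.1 := by ext i; rw [g2, g2', h]
    have k6 : z.2.2.2.2.2.2 = z'.2.2.2.2.2.2 := by
      rw [← g6 ⟨0, by omega⟩, ← g6' ⟨0, by omega⟩, k1, k2]
    have hξ : Sum.elim z.2.2.2.1 (π z.2.2.2.2.2.1) = Sum.elim z'.2.2.2.1 (π z'.2.2.2.2.2.1) := by
      ext cc
      have a1 := cramer_pt A b y0 K _ _ g5 cc
      have a2 := cramer_pt A b y0 K _ _ g5' cc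
      rw [← h, a1] at a2
      exact mul_left_cancel₀ g7 a2
    have k3 : z.2.2.2.1 = z'.2.2.2.1 := by
      ext j; simpa using congrFun hξ (Sum.inl j)
    have k5 : π z.2.2.2.2.2.1 = π z'.2.2.2.2.2.1 := by
      ext j; simpa using congrFun hξ (Sum.inr j)
    have k5' : z.2.2.2.2.2.1 = z'.2.2.2.2.2.1 := by rw [← g4, ← g4', k5]
    have k4 : z.2.2.2.2.1 = z'.2.2.2.2.1 := by rw [g3, g3', k3]
    exact Prod.ext k0 (Prod.ext k1 (Prod.ext k2 (Prod.ext k3 (Prod.ext k4 (Prod.ext k5' k6)))))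
  -- perturbation
  set r := n + k - 1 with hr
  let P : CPVars ℝ (n+k) n → (Fin (n+k) → ℝ) × (Fin n → ℝ) × (Fin (n+k) → ℝ) × (Fin (n+k) → ℝ) ×
      (Fin n → ℝ) × (Fin (n+k) → ℝ) × ℝ := fun z =>
    (0, 0, fun i => (if (i : ℕ) < r then 1 else 0) * pp n k i (prj z), 0, 0, 0,
      hh n k r (prj z) / (Mz A b y0 K (prj z)).det)
  have hprjC : ContDiff ℝ 1 prj := by
    have h1 : ContDiff ℝ 1 π := (LinearMap.toContinuousLinearMap π).contDiff
    refine ContDiff.prodMk contDiff_fst ?_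
    exact h1.comp (by fun_prop)
  have hdetC : ContDiff ℝ 1 (fun z => (Mz A b y0 K (prj z)).det) :=
    (det_contDiff A b y0 K).comp hprjC
  have hPC : ∀ z ∈ Sol, ContDiffAt ℝ 1 P z := by
    intro z hz
    refine contDiffAt_const.prodMk (contDiffAt_const.prodMk (ContDiffAt.prodMk ?_
      (contDiffAt_const.prodMk (contDiffAt_const.prodMk (contDiffAt_const.prodMk ?_)))))
    · rw [contDiffAt_pi]
      intro i
      exact (contDiff_const.mul ((pp_contDiff i).comp hprjC)).contDiffAt
    · exact ((hh_contDiff r).comp hprjC).contDiffAt.div hdetC.contDiffAt (struct0 z hz).2.2.2.2.2.2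
  obtain ⟨F, hF, hbez⟩ := bez (n := n) (k := k) (r := r) (by omega)
    (fun i => sF A b ⟨i, by omega⟩ * yF y0 K ⟨i, by omega⟩ -
      sF A b ⟨r, by omega⟩ * yF y0 K ⟨r, by omega⟩) (gg A b y0 K rho)
    (fun i => Submodule.sub_mem _ (Submodule.mul_mem_mul (sF_mem _ _ _) (yF_mem _ _ _))
      (Submodule.mul_mem_mul (sF_mem _ _ _) (yF_mem _ _ _))) (gg_mem A b y0 K rho) (B+1)
    (by rw [hr, count_eq n k hn hk]; omega)
  obtain ⟨V, hV, hVd⟩ := (Set.finite_range (prj ∘ zs)).t2_separation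
  have hev : ∀ j, ∀ᶠ ε in nhds (0:ℝ), ∃ z ∈ {z | prj z ∈ V (prj (zs j)) ∧ (Mz A b y0 K (prj z)).det ≠ 0},
      cpPhi A b c u v w z + ε • P z = 0 := by
    intro j
    have c1 := (cpPhi_contDiff A b c u v w).contDiffAt (x := zs j)
    refine persist _ P (zs j) _ _ (c1.hasStrictFDerivAt one_ne_zero)
      ((hPC _ (hzS j)).hasStrictFDerivAt one_ne_zero) (hzS j).2.2.2 (hzS j).2.1 _ ?_
    refine Filter.inter_mem ?_ ?_
    · exact hprjC.continuous.continuousAt ((hV _).2.mem_nhds (hV _).1)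
    · exact hdetC.continuous.continuousAt.eventually_ne (struct0 _ (hzS j)).2.2.2.2.2.2
  have hev' := Filter.eventually_all.mpr hev
  obtain ⟨ε, hε, hεF⟩ := ((infinite_of_mem_nhds (0:ℝ) hev').sdiff hF).nonempty
  have hε : ∀ j, ∃ z ∈ {z | prj z ∈ V (prj (zs j)) ∧ (Mz A b y0 K (prj z)).det ≠ 0},
      cpPhi A b c u v w z + ε • P z = 0 := hε
  choose zε hzε hzε0 using hε
  refine hbez ε hεF (fun j => prj (zε j)) ?_ ?_
  · intro i j hij
    by_contra hne
    have hne' : prj (zs i) ≠ prj (zs j) := fun h =>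
      hne (hzinj (hprj _ (hzS i) _ (hzS j) h))
    have hd := hVd ⟨i, rfl⟩ ⟨j, rfl⟩ hne'
    have hij : prj (zε i) = prj (zε j) := hij
    exact Set.disjoint_left.mp hd (hzε i).1 (hij ▸ (hzε j).1)
  · intro j
    have hdet := (hzε j).2
    have h0 := hzε0 j
    generalize zε j = z at hdet h0 ⊢
    simp only [cpPhi, P, Prod.ext_iff, Prod.fst_zero, Prod.snd_zero, Prod.fst_add, Prod.snd_add,
      Prod.smul_fst, Prod.smul_snd, smul_zero, add_zero] at h0
    obtain ⟨E1, E2, E3, E4, E5, E6, E7⟩ := h0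
    obtain ⟨g1, g2, g3, g4, g5⟩ := struct z E1 E2 E4 E5 (fun i => congrFun E6 i)
    constructor
    · intro i
      have a1 := congrFun E3 ⟨i, by omega⟩
      have a2 := congrFun E3 ⟨r, by omega⟩
      simp [g1, g2] at a1 a2
      simp
      linarith
    · have hsum : (∑ j, u j * z.2.2.2.1 j) + (∑ i, v i * z.2.2.2.2.1 i) +
          (∑ i, w i * z.2.2.2.2.2.1 i) =
          ∑ cc, rho cc * (Sum.elim z.2.2.2.1 (π z.2.2.2.2.2.1) : Fin n ⊕ Fin k → ℝ) cc := by
        rw [g3]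
        conv_lhs => rw [← g4]
        simp only [Fintype.sum_sum_type, rho, Sum.elim_inl, Sum.elim_inr, add_mul,
          Finset.sum_add_distrib, Matrix.mulVec, dotProduct, Finset.mul_sum, Finset.sum_mul]
        rw [Finset.sum_comm (f := fun i j => v i * (A i j * _)),
          Finset.sum_comm (f := fun i j => w i * (K i j * _))]
        simp only [mul_assoc]
      have hgg : gg A b y0 K rho (prj z) = (Mz A b y0 K (prj z)).det *
          ∑ cc, rho cc * (Sum.elim z.2.2.2.1 (π z.2.2.2.2.2.1) : Fin n ⊕ Fin k → ℝ) cc := by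
        simp only [gg, Finset.mul_sum]
        refine Finset.sum_congr rfl fun cc _ => ?_
        rw [cramer_pt A b y0 K _ _ g5 cc]
        ring
      rw [hsum] at E7
      rw [hgg]
      simp only [smul_eq_mul] at E7
      field_simp at E7
      linarith
end final
end CPB

/-- **Root count for the primal/dual case.** The number of nonsingular real solutions
with `μ > 0` of the system `Φ^{A,b,c,u,v,w} = 0` is at most `2·n·C(m-1, n)`. -/
theorem primal_dual_root_count
    (m n : ℕ) (hn : 1 ≤ n) (hmn : n < m)
    (A : Matrix (Fin m) (Fin n) ℝ) (hA : A.rank = n)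
    (b : Fin m → ℝ) (c : Fin n → ℝ) (hc : c ≠ 0)
    (u : Fin n → ℝ) (v w : Fin m → ℝ) (huvw : ¬(u = 0 ∧ v = 0 ∧ w = 0)) :
    Set.encard {z : CPVars ℝ m n |
        0 < z.2.2.2.2.2.2 ∧ cpPhi A b c u v w z = 0 ∧
        Function.Bijective (fderiv ℝ (cpPhi A b c u v w) z)}
      ≤ ((2 * n * (m - 1).choose n : ℕ) : ℕ∞) := by

  obtain ⟨k, rfl⟩ : ∃ k, m = n + k := ⟨m - n, by omega⟩
  exact CPB.main n k hn (by omega) A hA b c u v w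
end

section
/- Let m > n ≥ 1, let A be a real m×n matrix of rank n, let b ∈ ℝ^m, let c ∈ ℝ^n be nonzero, let u ∈ ℝ^n, v ∈ ℝ^m be not both zero, and let w = 0. Then the set of points z = (x, s, y, ẋ, ṡ, ẏ, μ) ∈ ℝ^n × ℝ^m × ℝ^m × ℝ^n × ℝ^m × ℝ^m × ℝ with μ > 0, Φ^{A,b,c,u,v,0}(z) = 0, and the derivative DΦ^{A,b,c,u,v,0}(z) invertible, has cardinality at most 2·(n−1)·C(m−1,n), where C(m−1,n) is the binomial coefficient. -/
/-- all maximal minors are nonzero -/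
def CPGen {m n : ℕ} (M : Matrix (Fin m) (Fin (n+1)) ℝ) : Prop :=
  ∀ f : Fin (n+1) ↪ Fin m, (M.submatrix f id).det ≠ 0

lemma cp_gen_dual {m n : ℕ} {M : Matrix (Fin m) (Fin (n+1)) ℝ} (hM : CPGen M) (hmn : n < m)
    (E : Finset (Fin m)) (hE : E.card ≤ n + 1) (e : Fin m) (he : e ∈ E) :
    ∃ ξ : Fin (n+1) → ℝ, M.mulVec ξ e = 1 ∧ ∀ i ∈ E, i ≠ e → M.mulVec ξ i = 0 := by
  obtain ⟨K, hEK, hK⟩ := Finset.exists_superset_card_eq hE (by simpa using hmn)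
  let f := K.orderEmbOfFin hK
  have hdet := hM f.toEmbedding
  have hr : ∀ i ∈ K, ∃ k, f k = i := by
    intro i hi
    have : i ∈ Set.range f := by rw [Finset.range_orderEmbOfFin]; exact hi
    exact this
  obtain ⟨k, hk⟩ := hr e (hEK he)
  set N := M.submatrix f.toEmbedding id with hN
  have hu : IsUnit N.det := isUnit_iff_ne_zero.mpr hdet
  have h1 : N.mulVec (N⁻¹.mulVec (Pi.single k 1)) = Pi.single k 1 := by
    rw [Matrix.mulVec_mulVec, Matrix.mul_nonsing_inv _ hu, Matrix.one_mulVec]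
  have h2 : ∀ l, M.mulVec (N⁻¹.mulVec (Pi.single k 1)) (f l) = (Pi.single k 1 : Fin (n+1) → ℝ) l := by
    intro l
    exact congrFun h1 l
  refine ⟨N⁻¹.mulVec (Pi.single k 1), ?_, ?_⟩
  · rw [← hk, h2]; simp
  · intro i hi hie
    obtain ⟨l, rfl⟩ := hr i (hEK hi)
    rw [h2, Pi.single_eq_of_ne]
    rintro rfl; exact hie hk

lemma cp_gen_inj {m n : ℕ} {M : Matrix (Fin m) (Fin (n+1)) ℝ} (hM : CPGen M)
    (E : Finset (Fin m)) (hE : E.card = n + 1) (ξ : Fin (n+1) → ℝ)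
    (h : ∀ i ∈ E, M.mulVec ξ i = 0) : ξ = 0 := by
  let f := E.orderEmbOfFin hE
  have hdet := hM f.toEmbedding
  refine Matrix.eq_zero_of_mulVec_eq_zero hdet ?_
  funext l
  exact h (f l) (Finset.orderEmbOfFin_mem E hE l)

lemma cp_span_pow {A α : Type*} [CommRing A] [Algebra ℝ A] (w : α → A) (k : ℕ) :
    (Submodule.span ℝ (Set.range w)) ^ k =
      Submodule.span ℝ (Set.range fun s : Sym α k => ((s : Multiset α).map w).prod) := by
  rw [Submodule.span_pow]
  congr 1
  ext a
  rw [Set.mem_pow]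
  constructor
  · rintro ⟨f, rfl⟩
    choose g hg using fun i => (f i).2
    refine ⟨⟨(List.ofFn g : List α), by simp⟩, ?_⟩
    simp [List.map_ofFn, Function.comp_def, hg]
  · rintro ⟨⟨s, hs⟩, rfl⟩
    induction s using Quot.inductionOn with
    | h l =>
      obtain rfl : l.length = k := hs
      refine ⟨fun i => ⟨w (l.get i), ⟨_, rfl⟩⟩, ?_⟩
      have : List.ofFn (fun i => w (l.get i)) = l.map w := by
        apply List.ext_get <;> simp
      simp only [this]
      rfl

open scoped Pointwise in
lemma cp_finrank_pow {A α β : Type*} [CommRing A] [Algebra ℝ A] [Fintype α] [Fintype β]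
    (w : α → A) (w' : β → A) (k l : ℕ) :
    ∃ S : Finset A, S.card ≤ (Fintype.card α + k - 1).choose k * (Fintype.card β + l - 1).choose l ∧
    (Submodule.span ℝ (Set.range w)) ^ k * (Submodule.span ℝ (Set.range w')) ^ l
       = Submodule.span ℝ (S : Set A) := by
  classical
  rw [cp_span_pow, cp_span_pow, Submodule.span_mul_span]
  refine ⟨(Finset.univ.image fun s : Sym α k => ((s : Multiset α).map w).prod) *
    (Finset.univ.image fun s : Sym β l => ((s : Multiset β).map w').prod), ?_, ?_⟩
  · refine (Finset.card_mul_le).trans ?_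
    refine Nat.mul_le_mul ?_ ?_
    · refine Finset.card_image_le.trans ?_
      rw [Finset.card_univ, Sym.card_sym_eq_choose]
    · refine Finset.card_image_le.trans ?_
      rw [Finset.card_univ, Sym.card_sym_eq_choose]
  · simp

section
variable {X : Type} {m n : ℕ} (y : Fin m → X → ℝ)

/-- span of 1 and coordinates -/
def cpY : Submodule ℝ (X → ℝ) := Submodule.span ℝ (Set.range fun o : Option (Fin m) => o.elim 1 y)

lemma cpY_one : (1 : X → ℝ) ∈ cpY y := Submodule.subset_span ⟨none, rfl⟩
lemma cpY_mem (i : Fin m) : y i ∈ cpY y := Submodule.subset_span ⟨some i, rfl⟩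

lemma cpY_prod (s : Multiset (Fin m)) : (s.map y).prod ∈ cpY y ^ s.card := by
  induction s using Multiset.induction_on with
  | empty => simpa using ⟨1, map_one _⟩
  | cons a s ih =>
    rw [Multiset.map_cons, Multiset.prod_cons, Multiset.card_cons, pow_succ']
    exact Submodule.mul_mem_mul (cpY_mem y a) ih

lemma cp_key_mono {M : Matrix (Fin m) (Fin (n+1)) ℝ} (hM : CPGen M) (hmn : n < m)
    (hT : ∀ x, ∃ ξ, ∀ i, y i x * M.mulVec ξ i = 1) (Θ : Submodule ℝ (X → ℝ))
    (hΘ : ∀ ξ, ∑ i, M.mulVec ξ i • y i ∈ Θ) (N : ℕ) :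
    ∀ s : Multiset (Fin m), s.card = n + 1 → n + 1 - s.toFinset.card ≤ N →
      (s.map y).prod ∈ Θ * cpY y ^ n := by
  induction N with
  | zero =>
    intro s hs hN
    have hle := Multiset.toFinset_card_le s
    have hnd : s.Nodup := by
      rw [← Multiset.toFinset_card_eq_card_iff_nodup]; omega
    set E := s.toFinset with hE
    have hEs : E.val = s := by simp [hE, hnd.dedup]
    have hEc : E.card = n + 1 := by rw [Finset.card, hEs, hs]
    have hprod : (s.map y).prod = ∏ i ∈ E, y i := by rw [← hEs]; rfl
    choose σ hσ1 hσ0 using fun f : E => cp_gen_dual hM hmn E hEc.le f.1 f.2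
    have key : (m : ℝ) • (s.map y).prod
        = ∑ f : E, (∑ i, M.mulVec (σ f) i • y i) * ∏ j ∈ E.erase f, y j := by
      rw [hprod]
      funext x
      obtain ⟨ξ, hξ⟩ := hT x
      have hexp : ξ = ∑ f : E, (M.mulVec ξ f) • σ f := by
        rw [← sub_eq_zero]
        apply cp_gen_inj hM E hEc
        intro i hi
        rw [Matrix.mulVec_sub, Matrix.mulVec_sum, Pi.sub_apply, Finset.sum_apply,
          Finset.sum_eq_single ⟨i, hi⟩]
        · rw [Matrix.mulVec_smul, Pi.smul_apply, hσ1 ⟨i, hi⟩]; simp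
        · intro b _ hb
          rw [Matrix.mulVec_smul, Pi.smul_apply, hσ0 b i hi]; · simp
          rintro rfl; exact hb rfl
        · simp
      have hi : ∀ i, ∏ j ∈ E, y j x = ∑ f : E, M.mulVec (σ f) i * y i x * ∏ j ∈ E.erase f, y j x := by
        intro i
        have h1 : M.mulVec ξ i = ∑ f : E, M.mulVec ξ f * M.mulVec (σ f) i := by
          conv_lhs => rw [hexp]
          rw [Matrix.mulVec_sum, Finset.sum_apply]
          simp [Matrix.mulVec_smul]
        calc ∏ j ∈ E, y j x = (∏ j ∈ E, y j x) * (y i x * M.mulVec ξ i) := by rw [hξ, mul_one]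
          _ = _ := by
            rw [h1, Finset.mul_sum, Finset.mul_sum]
            refine Finset.sum_congr rfl fun f _ => ?_
            rw [← Finset.mul_prod_erase E (fun j => y j x) f.2]
            have := hξ f
            linear_combination (y i x * M.mulVec (σ f) i * ∏ j ∈ E.erase f, y j x) * this
      simp only [Pi.smul_apply, Finset.prod_apply, smul_eq_mul, Finset.sum_apply, Pi.mul_apply]
      calc (m : ℝ) * ∏ j ∈ E, y j x = ∑ i : Fin m, ∏ j ∈ E, y j x := by simp
        _ = ∑ i : Fin m, ∑ f : E, M.mulVec (σ f) i * y i x * ∏ j ∈ E.erase f, y j x :=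
            Finset.sum_congr rfl fun i _ => hi i
        _ = _ := by
          rw [Finset.sum_comm]
          simp only [Finset.sum_mul]
    have hm : (m : ℝ) ≠ 0 := by
      have : m ≠ 0 := by omega
      exact_mod_cast this
    have : (s.map y).prod = (m : ℝ)⁻¹ • ((m : ℝ) • (s.map y).prod) := by
      rw [smul_smul, inv_mul_cancel₀ hm, one_smul]
    rw [this, key]
    refine Submodule.smul_mem _ _ (Submodule.sum_mem _ fun f _ => Submodule.mul_mem_mul (hΘ _) ?_)
    have h := cpY_prod y (E.erase f).val
    have hc : (E.erase f.1).val.card = n := by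
      rw [Finset.card_val, Finset.card_erase_of_mem f.2, hEc]; rfl
    rw [hc] at h
    exact h
  | succ N ih =>
    intro s hs hN
    by_cases hlt : n + 1 - s.toFinset.card ≤ N
    · exact ih s hs hlt
    have hle := Multiset.toFinset_card_le s
    have hnd : ¬ s.Nodup := by
      rw [← Multiset.toFinset_card_eq_card_iff_nodup]; omega
    obtain ⟨e, he⟩ : ∃ e, 2 ≤ s.count e := by
      by_contra hcon
      push Not at hcon
      exact hnd (Multiset.nodup_iff_count_le_one.mpr fun a => by have := hcon a; omega)
    have hes : e ∈ s := Multiset.count_pos.mp (by omega)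
    obtain ⟨t, rfl⟩ := Multiset.exists_cons_of_mem hes
    have het : e ∈ t := by
      rw [Multiset.count_cons_self] at he
      exact Multiset.count_pos.mp (by omega)
    have htc : t.card = n := by simpa using hs
    have htf : (e ::ₘ t).toFinset = t.toFinset := by simp [het]
    rw [htf] at hN hlt
    obtain ⟨σ, h1, h0⟩ := cp_gen_dual hM hmn t.toFinset (by
      have := Multiset.toFinset_card_le t; omega) e (by simpa using het)
    have hy : y e = ∑ i, M.mulVec σ i • y i - ∑ i ∈ Finset.univ \ t.toFinset, M.mulVec σ i • y i := by
      rw [← Finset.sum_sdiff (Finset.subset_univ t.toFinset), add_sub_cancel_left,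
        Finset.sum_eq_single e]
      · rw [h1, one_smul]
      · intro b hb hbe; rw [h0 b hb hbe, zero_smul]
      · intro h; exact absurd (by simpa using het) h
    rw [Multiset.map_cons, Multiset.prod_cons]
    nth_rewrite 1 [hy]
    rw [sub_mul, Finset.sum_mul (Finset.univ \ t.toFinset)]
    refine Submodule.sub_mem _ (Submodule.mul_mem_mul (hΘ _) (htc ▸ cpY_prod y t)) ?_
    refine Submodule.sum_mem _ fun i hi => ?_
    rw [smul_mul_assoc]
    refine Submodule.smul_mem _ _ ?_
    have := ih (i ::ₘ t) (by simp [htc]) (by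
      have hit : i ∉ t.toFinset := (Finset.mem_sdiff.mp hi).2
      rw [Multiset.toFinset_cons, Finset.card_insert_of_notMem hit]
      omega)
    simpa using this

lemma cp_key {M : Matrix (Fin m) (Fin (n+1)) ℝ} (hM : CPGen M) (hmn : n < m)
    (hT : ∀ x, ∃ ξ, ∀ i, y i x * M.mulVec ξ i = 1) (Θ : Submodule ℝ (X → ℝ)) (h1 : 1 ∈ Θ)
    (hΘ : ∀ ξ, ∑ i, M.mulVec ξ i • y i ∈ Θ) : cpY y ^ (n+1) ≤ Θ * cpY y ^ n := by
  nth_rewrite 1 [cpY]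
  rw [cp_span_pow, Submodule.span_le]
  rintro _ ⟨⟨s, hs⟩, rfl⟩
  by_cases hn : none ∈ s
  · obtain ⟨t, rfl⟩ := Multiset.exists_cons_of_mem hn
    have htc : t.card = n := by simpa using hs
    simp only [Sym.coe_mk, Multiset.map_cons, Multiset.prod_cons, SetLike.mem_coe]
    refine Submodule.mul_mem_mul h1 ?_
    rw [cpY, cp_span_pow]
    exact Submodule.subset_span ⟨⟨t, htc⟩, rfl⟩
  · obtain ⟨t, rfl⟩ : ∃ t : Multiset (Fin m), s = t.map some := by
      refine ⟨s.filterMap id, ?_⟩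
      clear hs
      induction s using Multiset.induction_on with
      | empty => simp
      | cons a s ih =>
        simp only [Multiset.mem_cons, not_or] at hn
        cases a with
        | none => exact absurd rfl hn.1
        | some a =>
          rw [Multiset.filterMap_cons_some id _ _ (b := a) rfl, Multiset.map_cons, ← ih hn.2]
    have htc : t.card = n + 1 := by simpa using hs
    have := cp_key_mono y hM hmn hT Θ hΘ (n+1) t htc (by omega)
    simpa [Multiset.map_map, Function.comp_def] using this

end

section
variable {X : Type} {m n : ℕ} (y : Fin m → X → ℝ)

lemma cp_hilb {M : Matrix (Fin m) (Fin (n+1)) ℝ} (hM : CPGen M) (hmn : n < m)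
    (hT : ∀ x, ∃ ξ, ∀ i, y i x * M.mulVec ξ i = 1) (c : Fin n → ℝ)
    (hc : ∀ x k, ∑ i, M i (Fin.castSucc k) * y i x = c k) (k : ℕ) :
    Module.finrank ℝ ↥(cpY y ^ (n + k)) ≤ (n + k + 1) * (m - 1).choose n := by
  classical
  let t : X → ℝ := ∑ i, M i (Fin.last n) • y i
  let Θ : Submodule ℝ (X → ℝ) := Submodule.span ℝ (Set.range ![1, t])
  have h1 : (1 : X → ℝ) ∈ Θ := Submodule.subset_span ⟨0, rfl⟩
  have ht : t ∈ Θ := Submodule.subset_span ⟨1, rfl⟩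
  have hΘ : ∀ ξ, ∑ i, M.mulVec ξ i • y i ∈ Θ := by
    intro ξ
    have : ∑ i, M.mulVec ξ i • y i = (∑ k, ξ (Fin.castSucc k) * c k) • (1 : X → ℝ)
        + ξ (Fin.last n) • t := by
      funext x
      simp only [t, Finset.sum_apply, Pi.smul_apply, Pi.add_apply, smul_eq_mul, Pi.one_apply, mul_one]
      simp only [← hc x, Matrix.mulVec, dotProduct, Finset.mul_sum, Finset.sum_mul]
      rw [Finset.sum_comm, Fin.sum_univ_castSucc]
      congr 1
      · refine Finset.sum_congr rfl fun k _ => Finset.sum_congr rfl fun i _ => by ring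
      · exact Finset.sum_congr rfl fun i _ => by ring
    rw [this]
    exact Submodule.add_mem _ (Submodule.smul_mem _ _ h1) (Submodule.smul_mem _ _ ht)
  obtain ⟨K, -, hK⟩ := Finset.exists_superset_card_eq (s := (∅ : Finset (Fin m))) (n := n + 1)
    (by simp) (by simpa using hmn)
  let w : Option {i // i ∉ K} → X → ℝ := fun o => o.elim 1 (fun i => y i)
  let W : Submodule ℝ (X → ℝ) := Submodule.span ℝ (Set.range w)
  have hW1 : (1 : X → ℝ) ∈ W := Submodule.subset_span ⟨none, rfl⟩
  have hWy : ∀ i, i ∉ K → y i ∈ W := fun i hi => Submodule.subset_span ⟨some ⟨i, hi⟩, rfl⟩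
  have hWle : W ≤ Θ * W := by
    intro a ha
    rw [← one_mul a]
    exact Submodule.mul_mem_mul h1 ha
  have hΘle : Θ ≤ Θ * W := by
    intro a ha
    rw [← mul_one a]
    exact Submodule.mul_mem_mul ha hW1
  have hY : cpY y ≤ Θ * W := by
    rw [cpY, Submodule.span_le]
    rintro _ ⟨o, rfl⟩
    cases o with
    | none => exact hWle hW1
    | some i =>
      by_cases hi : i ∈ K
      · obtain ⟨σ, hs1, hs0⟩ := cp_gen_dual hM hmn K hK.le i hi
        have hy : y i = ∑ i, M.mulVec σ i • y i - ∑ i ∈ Finset.univ \ K, M.mulVec σ i • y i := by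
          rw [← Finset.sum_sdiff (Finset.subset_univ K), add_sub_cancel_left,
            Finset.sum_eq_single i]
          · rw [hs1, one_smul]
          · intro b hb hbe; rw [hs0 b hb hbe, zero_smul]
          · intro h; exact absurd hi h
        change y i ∈ Θ * W
        rw [hy]
        refine Submodule.sub_mem _ (hΘle (hΘ _)) (Submodule.sum_mem _ fun j hj => ?_)
        exact Submodule.smul_mem _ _ (hWle (hWy j (Finset.mem_sdiff.mp hj).2))
      · exact hWle (hWy i hi)
  have hmain : ∀ k, cpY y ^ (n + k) ≤ Θ ^ (n + k) * W ^ n := by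
    intro k
    induction k with
    | zero =>
      rw [add_zero, ← mul_pow]
      exact pow_le_pow_left' hY n
    | succ k ih =>
      calc cpY y ^ (n + (k+1)) = cpY y ^ (n + 1) * cpY y ^ k := by rw [← pow_add]; congr 1; ring
        _ ≤ (Θ * cpY y ^ n) * cpY y ^ k := mul_le_mul_left (cp_key y hM hmn hT Θ h1 hΘ) _
        _ = Θ * cpY y ^ (n + k) := by rw [mul_assoc, ← pow_add]
        _ ≤ Θ * (Θ ^ (n + k) * W ^ n) := mul_le_mul_right ih _
        _ = _ := by rw [← mul_assoc, ← pow_succ', add_assoc]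
  obtain ⟨S, hS, hSs⟩ := cp_finrank_pow ![1, t] w (n + k) n
  have hle : cpY y ^ (n + k) ≤ Submodule.span ℝ (S : Set (X → ℝ)) := by
    rw [← hSs]; exact hmain k
  refine (Submodule.finrank_mono hle).trans ((finrank_span_finset_le_card S).trans (hS.trans ?_))
  apply le_of_eq
  have e1 : Fintype.card (Fin 2) + (n + k) - 1 = n + k + 1 := by simp; omega
  have e2 : Fintype.card (Option {i // i ∉ K}) + n - 1 = m - 1 := by
    rw [Fintype.card_option, Fintype.card_subtype_compl]
    simp [hK]
    omega
  rw [e1, e2, Nat.choose_succ_self_right]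

lemma cpY_finite (d : ℕ) : Module.Finite ℝ ↥(cpY y ^ d) := by
  obtain ⟨S, -, hS⟩ := cp_finrank_pow (fun o : Option (Fin m) => o.elim 1 y)
    (fun o : Option (Fin m) => o.elim 1 y) d 0
  rw [pow_zero, mul_one] at hS
  change Module.Finite ℝ ↥(Submodule.span ℝ (Set.range fun o : Option (Fin m) => o.elim 1 y) ^ d)
  rw [hS]
  infer_instance

lemma cpY_mono {d d' : ℕ} (h : d ≤ d') : cpY y ^ d ≤ cpY y ^ d' :=
  pow_le_pow_right' (Submodule.one_le.mpr (cpY_one y)) h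

lemma cp_interp {N : ℕ} (p : Fin N → X) (hp : Function.Injective fun j i => y i (p j)) (j : Fin N) :
    ∃ q ∈ cpY y ^ N, q (p j) = 1 ∧ ∀ k, k ≠ j → q (p k) = 0 := by
  classical
  have h1 : ∀ k, ∃ q ∈ cpY y, q (p j) = 1 ∧ (k ≠ j → q (p k) = 0) := by
    intro k
    by_cases hk : k = j
    · exact ⟨1, cpY_one y, rfl, fun h => absurd hk h⟩
    · obtain ⟨i, hi⟩ := Function.ne_iff.mp (fun h => hk (hp h) : (fun i => y i (p k)) ≠ fun i => y i (p j))
      refine ⟨(y i (p j) - y i (p k))⁻¹ • (y i - y i (p k) • (1 : X → ℝ)), ?_, ?_, fun _ => ?_⟩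
      · exact Submodule.smul_mem _ _ (Submodule.sub_mem _ (cpY_mem y i)
          (Submodule.smul_mem _ _ (cpY_one y)))
      · simp only [Pi.smul_apply, Pi.sub_apply, Pi.one_apply, smul_eq_mul, mul_one]
        exact inv_mul_cancel₀ (sub_ne_zero.mpr (Ne.symm hi))
      · simp
  choose q hqY hq1 hq0 using h1
  refine ⟨∏ k, q k, ?_, ?_, ?_⟩
  · have : ∀ s : Finset (Fin N), ∏ k ∈ s, q k ∈ cpY y ^ s.card := by
      intro s
      induction s using Finset.induction_on with
      | empty => simpa using ⟨1, map_one _⟩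
      | insert a s ha ih =>
        rw [Finset.prod_insert ha, Finset.card_insert_of_notMem ha, pow_succ']
        exact Submodule.mul_mem_mul (hqY a) ih
    simpa using this Finset.univ
  · simp [Finset.prod_apply, hq1]
  · intro k hk
    rw [Finset.prod_apply]
    exact Finset.prod_eq_zero (Finset.mem_univ k) (hq0 k hk)

lemma cp_step {N e : ℕ} (p : Fin N → X) (hp : Function.Injective fun j i => y i (p j))
    (F : X → ℝ) (hF : F ∈ cpY y ^ e) (hF0 : ∀ j, F (p j) = 0)
    (hinj : ∀ d, ∀ q ∈ cpY y ^ d, F * q = 0 → q = 0) (d : ℕ) (hd : N ≤ d + e) :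
    Module.finrank ℝ ↥(cpY y ^ d) + N ≤ Module.finrank ℝ ↥(cpY y ^ (d + e)) := by
  classical
  have := cpY_finite y d
  have := cpY_finite y (d + e)
  let ev : (X → ℝ) →ₗ[ℝ] (Fin N → ℝ) := LinearMap.funLeft ℝ ℝ p
  let ev' := ev.domRestrict (cpY y ^ (d + e))
  have hsurj : LinearMap.range ev' = ⊤ := by
    rw [LinearMap.range_eq_top]
    intro a
    choose q hq hq1 hq0 using cp_interp y p hp
    refine ⟨⟨∑ j, a j • q j, Submodule.sum_mem _ fun j _ => Submodule.smul_mem _ _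
      (cpY_mono y hd (hq j))⟩, ?_⟩
    funext k
    change (∑ j, a j • q j) (p k) = a k
    rw [Finset.sum_apply, Finset.sum_eq_single k]
    · simp [hq1]
    · intro b _ hb; simp [hq0 b k hb.symm]
    · simp
  have hrk := LinearMap.finrank_range_add_finrank_ker ev'
  rw [hsurj, finrank_top, Module.finrank_fin_fun] at hrk
  let g : ↥(cpY y ^ d) →ₗ[ℝ] ↥(LinearMap.ker ev') :=
    LinearMap.codRestrict _ (LinearMap.codRestrict (cpY y ^ (d + e))
      ((LinearMap.mulLeft ℝ F).domRestrict (cpY y ^ d)) (by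
        intro q
        change F * q.1 ∈ _
        rw [add_comm, pow_add]
        exact Submodule.mul_mem_mul hF q.2)) (by
      intro q
      rw [LinearMap.mem_ker]
      funext k
      change F (p k) * q.1 (p k) = 0
      rw [hF0, zero_mul])
  have hg : Function.Injective g := by
    rw [injective_iff_map_eq_zero]
    intro q hq
    apply Subtype.ext
    apply hinj d q.1 q.2
    exact congrArg (fun z => z.1.1) hq
  have := LinearMap.finrank_le_finrank_of_injective hg
  omega

lemma cp_count {N e D a : ℕ} (p : Fin N → X) (hp : Function.Injective fun j i => y i (p j))
    (F : X → ℝ) (hF : F ∈ cpY y ^ e) (hF0 : ∀ j, F (p j) = 0)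
    (hinj : ∀ d, ∀ q ∈ cpY y ^ d, F * q = 0 → q = 0)
    (hfin : ∀ k, Module.finrank ℝ ↥(cpY y ^ (a + k)) ≤ (a + k + 1) * D) : N ≤ e * D := by
  have h : ∀ k, k * N ≤ Module.finrank ℝ ↥(cpY y ^ (a + (N + k * e))) := by
    intro k
    induction k with
    | zero => simp
    | succ k ih =>
      have := cp_step y p hp F hF hF0 hinj (a + (N + k * e)) (by omega)
      have e1 : a + (N + (k+1) * e) = a + (N + k * e) + e := by ring
      rw [e1]
      have e2 : (k + 1) * N = k * N + N := by ring
      omega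
  by_contra hcon
  push Not at hcon
  have h2 := (h ((a + N + 1) * D + 1)).trans (hfin _)
  have h3 : ((a + N + 1) * D + 1) * (e * D + 1) ≤ ((a + N + 1) * D + 1) * N :=
    Nat.mul_le_mul_left _ hcon
  nlinarith
end

lemma cp_van (m n : ℕ) : ∃ V : Matrix (Fin m) (Fin (n+1)) ℝ, ∀ M : Matrix (Fin m) (Fin (n+1)) ℝ,
    ∀ δ > 0, ∃ ε : ℝ, |ε| < δ ∧ CPGen (M + ε • V) := by
  classical
  let V : Matrix (Fin m) (Fin (n+1)) ℝ := Matrix.of fun i k => ((i : ℕ) : ℝ) ^ (k : ℕ)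
  refine ⟨V, fun M δ hδ => ?_⟩
  let P : (Fin (n+1) ↪ Fin m) → Polynomial ℝ := fun f =>
    Matrix.det ((Polynomial.X : Polynomial ℝ) • (V.submatrix f id).map Polynomial.C
      + (M.submatrix f id).map Polynomial.C)
  have hP : ∀ f, P f ≠ 0 := by
    intro f h
    have h1 := Polynomial.coeff_det_X_add_C_card (V.submatrix f id) (M.submatrix f id)
    change (P f).coeff _ = _ at h1
    rw [h, Polynomial.coeff_zero] at h1
    have h2 : V.submatrix f id = Matrix.vandermonde (fun k => (((f k : Fin m) : ℕ) : ℝ)) := rfl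
    rw [h2] at h1
    refine (Matrix.det_vandermonde_ne_zero_iff.mpr ?_) h1.symm
    intro a b hab
    simp only [Nat.cast_inj] at hab
    exact f.injective (Fin.ext hab)
  have hprod : ∏ f, P f ≠ 0 := Finset.prod_ne_zero_iff.mpr fun f _ => hP f
  have hinf : (Set.Ioo 0 δ).Infinite := Set.Ioo_infinite hδ
  obtain ⟨ε, hε, hεr⟩ := hinf.exists_notMem_finset (∏ f, P f).roots.toFinset
  refine ⟨ε, by rw [abs_of_pos hε.1]; exact hε.2, fun f => ?_⟩
  have h1 : (∏ f, P f).eval ε ≠ 0 := by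
    intro h
    apply hεr
    rw [Multiset.mem_toFinset, Polynomial.mem_roots hprod]
    exact h
  rw [Polynomial.eval_prod] at h1
  have h2 := Finset.prod_ne_zero_iff.mp h1 f (Finset.mem_univ f)
  convert h2 using 1
  rw [← Polynomial.coe_evalRingHom, RingHom.map_det]
  congr 1
  ext i j
  simp only [Matrix.submatrix_apply, Matrix.add_apply, Matrix.smul_apply, smul_eq_mul, id,
    RingHom.mapMatrix_apply, Matrix.map_apply, Polynomial.coe_evalRingHom, Polynomial.eval_add,
    Polynomial.eval_mul, Polynomial.eval_X, Polynomial.eval_C]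
  ring

lemma cp_prod_mem {X : Type} {m : ℕ} (y : Fin m → X → ℝ) {ι : Type*} (s : Finset ι)
    (f : ι → X → ℝ) (d : ι → ℕ) (h : ∀ i ∈ s, f i ∈ cpY y ^ d i) :
    ∏ i ∈ s, f i ∈ cpY y ^ (∑ i ∈ s, d i) := by
  classical
  induction s using Finset.induction_on with
  | empty => simpa using ⟨1, map_one _⟩
  | insert a s ha ih =>
    rw [Finset.prod_insert ha, Finset.sum_insert ha, pow_add]
    exact Submodule.mul_mem_mul (h a (by simp)) (ih fun i hi => h i (by simp [hi]))

/-- Hessian -/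
def cpH {m n : ℕ} (A : Matrix (Fin m) (Fin n) ℝ) (y : Fin m → ℝ) : Matrix (Fin n) (Fin n) ℝ :=
  Matrix.of fun j k => ∑ i, A i j * y i ^ 2 * A i k

lemma cp_F_mem {X : Type} {m n : ℕ} (y : Fin m → X → ℝ) (A : Matrix (Fin m) (Fin n) ℝ)
    (g c : Fin n → ℝ) :
    (fun x => g ⬝ᵥ (cpH A (fun i => y i x)).adjugate.mulVec c) ∈ cpY y ^ (2 * (n - 1)) := by
  classical
  have hH : ∀ j k, (fun x => cpH A (fun i => y i x) j k) ∈ cpY y ^ 2 := by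
    intro j k
    have : (fun x => cpH A (fun i => y i x) j k) = ∑ i, (A i j * A i k) • (y i * y i) := by
      funext x
      simp only [cpH, Matrix.of_apply, Finset.sum_apply, Pi.smul_apply, Pi.mul_apply, smul_eq_mul]
      exact Finset.sum_congr rfl fun i _ => by ring
    rw [this]
    refine Submodule.sum_mem _ fun i _ => Submodule.smul_mem _ _ ?_
    rw [pow_two]
    exact Submodule.mul_mem_mul (cpY_mem y i) (cpY_mem y i)
  have hadj : ∀ j k, (fun x => (cpH A (fun i => y i x)).adjugate j k) ∈ cpY y ^ (2 * (n - 1)) := by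
    intro j k
    have : (fun x => (cpH A (fun i => y i x)).adjugate j k) =
        ∑ σ : Equiv.Perm (Fin n), (((Equiv.Perm.sign σ : ℤ) : ℝ)) •
          ∏ i, (fun x => ((cpH A (fun i => y i x)).updateRow k (Pi.single j 1)) (σ i) i) := by
      funext x
      rw [Matrix.adjugate_apply, Matrix.det_apply]
      simp only [Finset.sum_apply, Pi.smul_apply, Finset.prod_apply]
      refine Finset.sum_congr rfl fun σ _ => ?_
      rw [Units.smul_def, zsmul_eq_mul, smul_eq_mul]
    rw [this]
    refine Submodule.sum_mem _ fun σ _ => Submodule.smul_mem _ _ ?_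
    have hd : ∑ i : Fin n, (if σ i = k then 0 else 2) = 2 * (n - 1) := by
      rw [Equiv.sum_comp σ (fun i => if i = k then 0 else 2), Finset.sum_ite]
      simp [Finset.filter_ne', mul_comm]
    rw [← hd]
    refine cp_prod_mem y _ _ _ fun i _ => ?_
    by_cases hi : σ i = k
    · simp only [hi, if_true, Matrix.updateRow_self, pow_zero]
      rw [Submodule.mem_one]
      exact ⟨(Pi.single j 1 : Fin n → ℝ) i, rfl⟩
    · simp only [hi, if_false, Matrix.updateRow_ne hi]
      exact hH _ _
  have : (fun x => g ⬝ᵥ (cpH A (fun i => y i x)).adjugate.mulVec c) =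
      ∑ j, ∑ k, (g j * c k) • fun x => (cpH A (fun i => y i x)).adjugate j k := by
    funext x
    simp only [dotProduct, Matrix.mulVec, Finset.sum_apply, Pi.smul_apply, smul_eq_mul,
      Finset.mul_sum]
    exact Finset.sum_congr rfl fun j _ => Finset.sum_congr rfl fun k _ => by ring
  rw [this]
  exact Submodule.sum_mem _ fun j _ => Submodule.sum_mem _ fun k _ => Submodule.smul_mem _ _ (hadj j k)

/-- first columns -/
def cpA {m n : ℕ} (M : Matrix (Fin m) (Fin (n+1)) ℝ) : Matrix (Fin m) (Fin n) ℝ :=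
  Matrix.of fun i k => M i (Fin.castSucc k)
/-- last column -/
def cpb {m n : ℕ} (M : Matrix (Fin m) (Fin (n+1)) ℝ) : Fin m → ℝ := fun i => M i (Fin.last n)

lemma cp_mulVec {m n : ℕ} (M : Matrix (Fin m) (Fin (n+1)) ℝ) (x : Fin n → ℝ) (a : ℝ) (i : Fin m) :
    M.mulVec (Fin.snoc x a : Fin (n+1) → ℝ) i = (cpA M).mulVec x i + a * cpb M i := by
  simp [Matrix.mulVec, dotProduct, Fin.sum_univ_castSucc, cpA, cpb, mul_comm a]

lemma cp_inj {m n : ℕ} {M : Matrix (Fin m) (Fin (n+1)) ℝ} (hM : CPGen M) (hmn : n < m)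
    {ξ ξ' : Fin (n+1) → ℝ} (h : M.mulVec ξ = M.mulVec ξ') : ξ = ξ' := by
  obtain ⟨K, -, hK⟩ := Finset.exists_superset_card_eq (s := (∅ : Finset (Fin m))) (n := n + 1)
    (by simp) (by simpa using hmn)
  rw [← sub_eq_zero]
  refine cp_gen_inj hM K hK _ fun i _ => ?_
  rw [Matrix.mulVec_sub, h, sub_self]; rfl

lemma cpA_inj {m n : ℕ} {M : Matrix (Fin m) (Fin (n+1)) ℝ} (hM : CPGen M) (hmn : n < m)
    {x : Fin n → ℝ} (h : (cpA M).mulVec x = 0) : x = 0 := by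
  have : (Fin.snoc x 0 : Fin (n+1) → ℝ) = 0 := by
    apply cp_inj hM hmn
    funext i
    rw [cp_mulVec, h]; simp
  funext k
  have := congrFun this (Fin.castSucc k)
  simpa using this

lemma cpH_mulVec {m n : ℕ} (A : Matrix (Fin m) (Fin n) ℝ) (y : Fin m → ℝ) (x : Fin n → ℝ) (j) :
    (cpH A y).mulVec x j = ∑ i, A i j * (y i ^ 2 * A.mulVec x i) := by
  simp only [cpH, Matrix.mulVec, dotProduct, Matrix.of_apply, Finset.sum_mul, Finset.mul_sum]
  rw [Finset.sum_comm]
  exact Finset.sum_congr rfl fun j _ => Finset.sum_congr rfl fun k _ => by ring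

lemma cpH_det {m n : ℕ} {M : Matrix (Fin m) (Fin (n+1)) ℝ} (hM : CPGen M) (hmn : n < m)
    (y : Fin m → ℝ) (hy : ∀ i, y i ≠ 0) : (cpH (cpA M) y).det ≠ 0 := by
  intro h
  obtain ⟨x, hx0, hx⟩ := Matrix.exists_mulVec_eq_zero_iff.mpr h
  apply hx0
  apply cpA_inj hM hmn
  have h1 : ∑ i, (y i * (cpA M).mulVec x i) ^ 2 = 0 := by
    calc ∑ i, (y i * (cpA M).mulVec x i) ^ 2
        = ∑ j, x j * (cpH (cpA M) y).mulVec x j := by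
          simp only [cpH_mulVec, Finset.mul_sum]
          rw [Finset.sum_comm]
          refine Finset.sum_congr rfl fun i _ => ?_
          have : (cpA M).mulVec x i = ∑ j, cpA M i j * x j := rfl
          calc (y i * (cpA M).mulVec x i) ^ 2
              = (∑ j, cpA M i j * x j) * (y i ^ 2 * (cpA M).mulVec x i) := by rw [← this]; ring
            _ = _ := by
              rw [Finset.sum_mul]
              exact Finset.sum_congr rfl fun j _ => by ring
      _ = 0 := by rw [hx]; simp
  rw [Finset.sum_eq_zero_iff_of_nonneg (fun i _ => sq_nonneg _)] at h1
  funext i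
  have := h1 i (Finset.mem_univ i)
  have := pow_eq_zero_iff (two_ne_zero) |>.mp this
  exact (mul_eq_zero.mp this).resolve_left (hy i)

section
variable {m n : ℕ} {M : Matrix (Fin m) (Fin (n+1)) ℝ}
  {c u : Fin n → ℝ} {v : Fin m → ℝ}

lemma cp_eqs {z : CPVars ℝ m n} {t : ℝ}
    (h : cpPhi (cpA M) (cpb M) c u v 0 z = (0, 0, 0, 0, 0, 0, t)) :
    (∀ i, (cpA M).mulVec z.1 i - z.2.1 i - cpb M i = 0) ∧
    (∀ k, ∑ i, M i (Fin.castSucc k) * z.2.2.1 i = c k) ∧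
    (∀ i, z.2.1 i * z.2.2.1 i = z.2.2.2.2.2.2) ∧
    (∀ i, z.2.2.2.2.1 i = (cpA M).mulVec z.2.2.2.1 i) ∧
    (∀ k, ∑ i, M i (Fin.castSucc k) * z.2.2.2.2.2.1 i = 0) ∧
    (∀ i, z.2.2.2.2.1 i * z.2.2.1 i + z.2.1 i * z.2.2.2.2.2.1 i = 1) ∧
    (∑ j, u j * z.2.2.2.1 j) + (∑ i, v i * z.2.2.2.2.1 i) = t := by
  simp only [cpPhi, Prod.mk.injEq] at h
  obtain ⟨h1, h2, h3, h4, h5, h6, h7⟩ := h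
  refine ⟨fun i => congrFun h1 i, fun k => ?_, fun i => ?_, fun i => ?_, fun k => ?_, fun i => ?_, ?_⟩
  · have := congrFun h2 k
    exact sub_eq_zero.mp this
  · exact sub_eq_zero.mp (congrFun h3 i)
  · exact (sub_eq_zero.mp (congrFun h4 i)).symm
  · exact congrFun h5 k
  · exact sub_eq_zero.mp (congrFun h6 i)
  · simpa using h7

lemma cp_sol_T {z : CPVars ℝ m n} {t : ℝ}
    (h : cpPhi (cpA M) (cpb M) c u v 0 z = (0, 0, 0, 0, 0, 0, t)) (hμ : 0 < z.2.2.2.2.2.2) (i : Fin m) :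
    z.2.2.1 i * M.mulVec (Fin.snoc ((z.2.2.2.2.2.2)⁻¹ • z.1) (-(z.2.2.2.2.2.2)⁻¹) : Fin (n+1) → ℝ) i
      = 1 := by
  obtain ⟨h1, h2, h3, h4, h5, h6, h7⟩ := cp_eqs h
  rw [cp_mulVec, Matrix.mulVec_smul]
  have e1 := h1 i
  have e3 := h3 i
  set μ := z.2.2.2.2.2.2
  simp only [Pi.smul_apply, smul_eq_mul]
  have : (cpA M).mulVec z.1 i - cpb M i = z.2.1 i := by linarith
  calc _ = μ⁻¹ * (((cpA M).mulVec z.1 i - cpb M i) * z.2.2.1 i) := by ring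
    _ = 1 := by rw [this, e3, inv_mul_cancel₀ hμ.ne']

lemma cp_sol_y {z : CPVars ℝ m n} {t : ℝ}
    (h : cpPhi (cpA M) (cpb M) c u v 0 z = (0, 0, 0, 0, 0, 0, t)) (hμ : 0 < z.2.2.2.2.2.2) (i : Fin m) :
    z.2.2.1 i ≠ 0 := by
  intro h0
  have := cp_sol_T h hμ i
  rw [h0, zero_mul] at this
  exact zero_ne_one this

lemma cp_sol_H {z : CPVars ℝ m n} {t : ℝ}
    (h : cpPhi (cpA M) (cpb M) c u v 0 z = (0, 0, 0, 0, 0, 0, t)) :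
    (cpH (cpA M) z.2.2.1).mulVec z.2.2.2.1 = c := by
  obtain ⟨h1, h2, h3, h4, h5, h6, h7⟩ := cp_eqs h
  funext k
  rw [cpH_mulVec]
  set μ := z.2.2.2.2.2.2
  have : ∀ i, cpA M i k * (z.2.2.1 i ^ 2 * (cpA M).mulVec z.2.2.2.1 i) =
      M i (Fin.castSucc k) * z.2.2.1 i - μ * (M i (Fin.castSucc k) * z.2.2.2.2.2.1 i) := by
    intro i
    rw [← h4 i]
    have e6 := h6 i
    have e3 := h3 i
    change M i (Fin.castSucc k) * _ = _
    linear_combination (M i (Fin.castSucc k) * z.2.2.1 i) * e6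
      - M i (Fin.castSucc k) * z.2.2.2.2.2.1 i * e3
  rw [Finset.sum_congr rfl fun i _ => this i, Finset.sum_sub_distrib, ← Finset.mul_sum, h5, h2]
  ring

lemma cp_sol_F {z : CPVars ℝ m n} {t : ℝ}
    (h : cpPhi (cpA M) (cpb M) c u v 0 z = (0, 0, 0, 0, 0, 0, t)) :
    (u + (cpA M).transpose.mulVec v) ⬝ᵥ (cpH (cpA M) z.2.2.1).adjugate.mulVec c
      = (cpH (cpA M) z.2.2.1).det * t := by
  have hH := cp_sol_H h
  obtain ⟨h1, h2, h3, h4, h5, h6, h7⟩ := cp_eqs h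
  nth_rewrite 1 [← hH]
  rw [Matrix.mulVec_mulVec, Matrix.adjugate_mul, Matrix.smul_mulVec, Matrix.one_mulVec,
    dotProduct_smul, smul_eq_mul]
  congr 1
  rw [← h7, add_dotProduct, Matrix.mulVec_transpose, ← Matrix.dotProduct_mulVec]
  congr 1
  simp only [dotProduct, h4]

lemma cp_sol_inj (hM : CPGen M) (hmn : n < m) {z z' : CPVars ℝ m n} {t t' : ℝ}
    (h : cpPhi (cpA M) (cpb M) c u v 0 z = (0, 0, 0, 0, 0, 0, t)) (hμ : 0 < z.2.2.2.2.2.2)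
    (h' : cpPhi (cpA M) (cpb M) c u v 0 z' = (0, 0, 0, 0, 0, 0, t')) (hμ' : 0 < z'.2.2.2.2.2.2)
    (hy : z.2.2.1 = z'.2.2.1) : z = z' := by
  have hT := cp_sol_T h hμ
  have hT' := cp_sol_T h' hμ'
  have hH := cp_sol_H h
  have hH' := cp_sol_H h'
  have hy0 := cp_sol_y h hμ
  obtain ⟨h1, h2, h3, h4, h5, h6, h7⟩ := cp_eqs h
  obtain ⟨h1', h2', h3', h4', h5', h6', h7'⟩ := cp_eqs h'
  obtain ⟨x, s, y, dx, ds, dy, μ⟩ := z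
  obtain ⟨x', s', y', dx', ds', dy', μ'⟩ := z'
  simp only at *
  subst hy
  have hξ := cp_inj hM hmn (funext fun i => mul_left_cancel₀ (hy0 i) ((hT i).trans (hT' i).symm))
  have hμe : μ = μ' := by
    have := congrFun hξ (Fin.last n)
    simpa using this
  subst hμe
  have hx : x = x' := by
    funext k
    have := congrFun hξ (Fin.castSucc k)
    simpa [hμ.ne'] using this
  subst hx
  have hs : s = s' := by
    funext i; linarith [h1 i, h1' i]
  subst hs
  have hdx : dx = dx' := by
    rw [← sub_eq_zero]
    refine Matrix.eq_zero_of_mulVec_eq_zero (cpH_det hM hmn y hy0) ?_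
    rw [Matrix.mulVec_sub, hH, hH', sub_self]
  subst hdx
  have hds : ds = ds' := by funext i; rw [h4, h4']
  subst hds
  have hdy : dy = dy' := by
    funext i
    have hs0 : s i ≠ 0 := by
      intro h0
      have := h3 i
      rw [h0, zero_mul] at this
      exact hμ.ne this
    apply mul_left_cancel₀ hs0
    linarith [h6 i, h6' i]
  subst hdy
  rfl
end

section
variable {m n : ℕ}

/-- perturbed map -/
noncomputable def cpPsi (M V : Matrix (Fin m) (Fin (n+1)) ℝ) (c u : Fin n → ℝ) (v : Fin m → ℝ)
    (p : ℝ × CPVars ℝ m n) :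
    ℝ × ((Fin m → ℝ) × (Fin n → ℝ) × (Fin m → ℝ) × (Fin m → ℝ) × (Fin n → ℝ) × (Fin m → ℝ) × ℝ) :=
  (p.1, cpPhi (cpA (M + p.1 • V)) (cpb (M + p.1 • V)) c u v 0 p.2)

lemma cpPsi_contDiff (M V : Matrix (Fin m) (Fin (n+1)) ℝ) (c u : Fin n → ℝ) (v : Fin m → ℝ) :
    ContDiff ℝ 1 (cpPsi M V c u v) := by
  unfold cpPsi cpPhi
  refine ContDiff.prodMk (by fun_prop) (ContDiff.prodMk ?_ (ContDiff.prodMk ?_ (ContDiff.prodMk ?_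
    (ContDiff.prodMk ?_ (ContDiff.prodMk ?_ (ContDiff.prodMk ?_ ?_))))))
  all_goals first
    | (rw [contDiff_pi]; intro i; simp only [Pi.sub_apply, Matrix.mulVec, cpA, cpb, dotProduct,
        Matrix.transpose_apply, Matrix.of_apply, Matrix.add_apply, Matrix.smul_apply, smul_eq_mul]; fun_prop)
    | fun_prop

lemma cp_arc (M V : Matrix (Fin m) (Fin (n+1)) ℝ) (c u : Fin n → ℝ) (v : Fin m → ℝ)
    (z₀ : CPVars ℝ m n) (h0 : cpPhi (cpA M) (cpb M) c u v 0 z₀ = 0)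
    (hbij : Function.Bijective (fderiv ℝ (cpPhi (cpA M) (cpb M) c u v 0) z₀))
    (U : Set (CPVars ℝ m n)) (hU : IsOpen U) (hz : z₀ ∈ U) :
    ∃ δ > 0, ∃ ζ : ℝ → ℝ → CPVars ℝ m n, ∀ ε, |ε| < δ →
      ContinuousOn (ζ ε) (Set.Ioo (-δ) δ) ∧ ∀ t ∈ Set.Ioo (-δ) δ, ζ ε t ∈ U ∧
        cpPhi (cpA (M + ε • V)) (cpb (M + ε • V)) c u v 0 (ζ ε t) = (0, 0, 0, 0, 0, 0, t) := by
  set Ψ := cpPsi M V c u v with hΨ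
  have hstrict : HasStrictFDerivAt Ψ (fderiv ℝ Ψ (0, z₀)) (0, z₀) :=
    (cpPsi_contDiff M V c u v).contDiffAt.hasStrictFDerivAt (by simp)
  set L := fderiv ℝ Ψ (0, z₀) with hL
  have hM0 : M + (0:ℝ) • V = M := by simp
  have hΨd : HasFDerivAt Ψ L (0, z₀) := hstrict.hasFDerivAt
  have hfst : ∀ w, (L w).1 = w.1 := by
    intro w
    have h1 : HasFDerivAt (fun p => (Ψ p).1) ((ContinuousLinearMap.fst ℝ _ _).comp L) (0, z₀) :=
      hΨd.fst
    have h2 : HasFDerivAt (fun p : ℝ × CPVars ℝ m n => p.1)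
        (ContinuousLinearMap.fst ℝ ℝ (CPVars ℝ m n)) (0, z₀) := hasFDerivAt_fst
    have := h1.unique h2
    exact congrArg (fun f => f w) this
  have hsnd : ∀ w, L (0, w) = (0, fderiv ℝ (cpPhi (cpA M) (cpb M) c u v 0) z₀ w) := by
    intro w
    have hinr : HasFDerivAt (fun z : CPVars ℝ m n => ((0:ℝ), z))
        (ContinuousLinearMap.inr ℝ ℝ (CPVars ℝ m n)) z₀ :=
      (hasFDerivAt_const (0:ℝ) z₀).prodMk (hasFDerivAt_id z₀)
    have h1 : HasFDerivAt (fun z => Ψ (0, z)) (L.comp (ContinuousLinearMap.inr ℝ ℝ (CPVars ℝ m n))) z₀ :=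
      HasFDerivAt.comp z₀ (f := fun z : CPVars ℝ m n => ((0:ℝ), z)) hΨd hinr
    have h2 : HasFDerivAt (fun z => (Ψ (0, z)).2) ((ContinuousLinearMap.snd ℝ _ _).comp
        (L.comp (ContinuousLinearMap.inr ℝ ℝ (CPVars ℝ m n)))) z₀ :=
      h1.snd
    have h3 : (fun z => (Ψ (0, z)).2) = cpPhi (cpA M) (cpb M) c u v 0 := by
      funext z
      simp only [hΨ, cpPsi, hM0]
    rw [h3] at h2
    rw [h2.fderiv]
    refine Prod.ext ?_ rfl
    exact hfst (0, w)
  have hinj : Function.Injective L := by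
    rw [injective_iff_map_eq_zero]
    rintro ⟨a, w⟩ h
    have ha : a = 0 := by
      have := hfst (a, w)
      rw [h] at this
      exact this.symm
    subst ha
    rw [hsnd] at h
    have h2 := congrArg Prod.snd h
    have : w = 0 := hbij.1 (by simpa using h2)
    rw [this]; rfl
  have hsurj : Function.Surjective L := by
    rintro ⟨a, w⟩
    obtain ⟨w', hw'⟩ := hbij.2 (w - (L (a, 0)).2)
    refine ⟨(a, w'), ?_⟩
    have : ((a, w') : ℝ × CPVars ℝ m n) = (a, 0) + (0, w') := by simp
    rw [this, map_add, hsnd, hw']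
    refine Prod.ext ?_ ?_
    · simp [hfst]
    · simp
  let Le := ContinuousLinearEquiv.ofBijective L (LinearMap.ker_eq_bot.mpr hinj)
    (LinearMap.range_eq_top.mpr hsurj)
  have hLe : (Le : _ →L[ℝ] _) = L := ContinuousLinearEquiv.coe_ofBijective _ _ _
  rw [← hLe] at hstrict
  let e := hstrict.toOpenPartialHomeomorph Ψ
  have he : ∀ p, e p = Ψ p := fun p => rfl
  have hsrc : ((0:ℝ), z₀) ∈ e.source := hstrict.mem_toOpenPartialHomeomorph_source
  have hval : Ψ (0, z₀) = (0, 0) := by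
    simp only [hΨ, cpPsi, hM0, h0]
  have htgt : ((0:ℝ), (0 : (Fin m → ℝ) × (Fin n → ℝ) × (Fin m → ℝ) × (Fin m → ℝ) × (Fin n → ℝ) × (Fin m → ℝ) × ℝ)) ∈ e.target := by
    rw [← hval]; exact e.map_source hsrc
  have hsymm : e.symm (0, 0) = (0, z₀) := by
    rw [← hval, ← he]; exact e.left_inv hsrc
  -- the open set
  have hO : IsOpen (e.target ∩ e.symm ⁻¹' (Prod.snd ⁻¹' U)) :=
    e.isOpen_inter_preimage_symm (hU.preimage continuous_snd)
  let ι : ℝ × ℝ → ℝ × ((Fin m → ℝ) × (Fin n → ℝ) × (Fin m → ℝ) × (Fin m → ℝ) × (Fin n → ℝ) × (Fin m → ℝ) × ℝ) :=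
    fun q => (q.1, 0, 0, 0, 0, 0, 0, q.2)
  have hι : Continuous ι := by fun_prop
  have hO' : IsOpen (ι ⁻¹' (e.target ∩ e.symm ⁻¹' (Prod.snd ⁻¹' U))) := hO.preimage hι
  have hmem : ((0:ℝ), (0:ℝ)) ∈ ι ⁻¹' (e.target ∩ e.symm ⁻¹' (Prod.snd ⁻¹' U)) := by
    refine ⟨htgt, ?_⟩
    change (e.symm (0, 0)).2 ∈ U
    rw [hsymm]; exact hz
  obtain ⟨δ, hδ, hball⟩ := Metric.isOpen_iff.mp hO' _ hmem
  have hin : ∀ ε t, |ε| < δ → t ∈ Set.Ioo (-δ) δ →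
      ι (ε, t) ∈ e.target ∩ e.symm ⁻¹' (Prod.snd ⁻¹' U) := by
    intro ε t hε ht
    apply hball
    rw [Metric.mem_ball, Prod.dist_eq, max_lt_iff]
    exact ⟨by simpa using hε, by simpa using abs_lt.mpr ht⟩
  refine ⟨δ, hδ, fun ε t => (e.symm (ι (ε, t))).2, fun ε hε => ⟨?_, fun t ht => ⟨?_, ?_⟩⟩⟩
  · refine continuous_snd.comp_continuousOn ?_
    refine e.continuousOn_symm.comp (Continuous.continuousOn (by fun_prop)) ?_
    intro t ht
    exact (hin ε t hε ht).1
  · exact (hin ε t hε ht).2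
  · have h1 : Ψ (e.symm (ι (ε, t))) = ι (ε, t) := by
      rw [← he]; exact e.right_inv (hin ε t hε ht).1
    have h2 : (e.symm (ι (ε, t))).1 = ε := congrArg Prod.fst h1
    have h3 := congrArg Prod.snd h1
    simp only [hΨ, cpPsi, h2] at h3
    exact h3

lemma cpY_cont {N : ℕ} {δ : ℝ} (y : Fin m → (Fin N × Set.Ioo (-δ) δ) → ℝ) (hy : ∀ i, Continuous (y i))
    (d : ℕ) (q) (hq : q ∈ cpY y ^ d) : Continuous q := by
  have h1 : ∀ q ∈ cpY y, Continuous q := by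
    intro q hq
    induction hq using Submodule.span_induction with
    | mem x h =>
      obtain ⟨o, rfl⟩ := h
      cases o with
      | none => exact continuous_one
      | some i => exact hy i
    | zero => exact continuous_zero
    | add x y _ _ hx hy => exact hx.add hy
    | smul a x _ hx => exact hx.const_smul a
  induction d generalizing q with
  | zero =>
    rw [pow_zero, Submodule.mem_one] at hq
    obtain ⟨a, rfl⟩ := hq
    exact continuous_const
  | succ d ih =>
    rw [pow_succ] at hq
    induction hq using Submodule.mul_induction_on' with
    | mem_mul_mem a ha b hb => exact (ih a ha).mul (h1 b hb)
    | add a _ b _ ha hb => exact ha.add hb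

lemma cp_bound (hmn : n < m) (A : Matrix (Fin m) (Fin n) ℝ)
    (b : Fin m → ℝ) (c : Fin n → ℝ) (u : Fin n → ℝ) (v : Fin m → ℝ) (N : ℕ)
    (zs : Fin N → CPVars ℝ m n) (hinj : Function.Injective zs)
    (hμ : ∀ j, 0 < (zs j).2.2.2.2.2.2) (h0 : ∀ j, cpPhi A b c u v 0 (zs j) = 0)
    (hbij : ∀ j, Function.Bijective (fderiv ℝ (cpPhi A b c u v 0) (zs j))) :
    N ≤ 2 * (n - 1) * (m - 1).choose n := by
  classical
  let M : Matrix (Fin m) (Fin (n+1)) ℝ := Matrix.of fun i => (Fin.snoc (A i) (b i) : Fin (n+1) → ℝ)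
  have hMA : cpA M = A := by ext i k; simp [cpA, M]
  have hMb : cpb M = b := by ext i; simp [cpb, M]
  rw [← hMA, ← hMb] at h0 hbij
  obtain ⟨V, hV⟩ := cp_van m n
  obtain ⟨U, hU, hdisj⟩ := (Set.finite_range zs).t2_separation
  have hpos : IsOpen {z : CPVars ℝ m n | 0 < z.2.2.2.2.2.2} :=
    isOpen_lt continuous_const (by fun_prop)
  choose δ hδ ζ hζ using fun j => cp_arc M V c u v (zs j) (h0 j) (hbij j)
    (U (zs j) ∩ {z : CPVars ℝ m n | 0 < z.2.2.2.2.2.2}) ((hU (zs j)).2.inter hpos)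
    ⟨(hU (zs j)).1, hμ j⟩
  obtain ⟨η, hη, hηle⟩ : ∃ η > 0, ∀ j, η ≤ δ j := by
    refine ⟨(Finset.univ.image δ ∪ {1}).min' (by simp), ?_, ?_⟩
    · rw [gt_iff_lt, Finset.lt_min'_iff]
      intro a ha
      simp only [Finset.mem_union, Finset.mem_image, Finset.mem_univ, true_and,
        Finset.mem_singleton] at ha
      rcases ha with ⟨j, rfl⟩ | rfl
      · exact hδ j
      · exact one_pos
    · intro j
      exact Finset.min'_le _ _ (by simp)
  obtain ⟨ε, hε, hgen⟩ := hV M η hη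
  have hsub : ∀ j, Set.Ioo (-η) η ⊆ Set.Ioo (-δ j) (δ j) := fun j =>
    Set.Ioo_subset_Ioo (neg_le_neg (hηle j)) (hηle j)
  set M' := M + ε • V with hM'
  have hsol : ∀ (x : Fin N × Set.Ioo (-η) η),
      cpPhi (cpA M') (cpb M') c u v 0 (ζ x.1 ε x.2) = (0, 0, 0, 0, 0, 0, (x.2 : ℝ)) := fun x =>
    ((hζ x.1 ε (hε.trans_le (hηle _))).2 x.2 (hsub _ x.2.2)).2
  have hin : ∀ (x : Fin N × Set.Ioo (-η) η), ζ x.1 ε x.2 ∈ U (zs x.1) ∧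
      0 < (ζ x.1 ε x.2).2.2.2.2.2.2 := fun x =>
    ((hζ x.1 ε (hε.trans_le (hηle _))).2 x.2 (hsub _ x.2.2)).1
  let y : Fin m → (Fin N × Set.Ioo (-η) η) → ℝ := fun i x => (ζ x.1 ε x.2).2.2.1 i
  have hycont : ∀ i, Continuous (y i) := by
    intro i
    refine continuous_prod_of_discrete_left.mpr fun j => ?_
    have h1 : Continuous fun t : Set.Ioo (-η) η => ζ j ε t :=
      ((hζ j ε (hε.trans_le (hηle _))).1.mono (hsub j)).domRestrict
    exact (continuous_apply i).comp (continuous_fst.comp (continuous_snd.comp (continuous_snd.comp h1)))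
  let zero : Set.Ioo (-η) η := ⟨0, by simpa using hη⟩
  let F : (Fin N × Set.Ioo (-η) η) → ℝ := fun x =>
    (u + (cpA M').transpose.mulVec v) ⬝ᵥ (cpH (cpA M') (fun i => y i x)).adjugate.mulVec c
  have hF : ∀ x, F x = (cpH (cpA M') (fun i => y i x)).det * (x.2 : ℝ) := fun x => cp_sol_F (hsol x)
  refine cp_count y (a := n) (fun j => (j, zero)) ?_ F (cp_F_mem y _ _ _) ?_ ?_ ?_
  · intro j k hjk
    by_contra hne
    have hz : ζ j ε (0:ℝ) = ζ k ε (0:ℝ) :=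
      cp_sol_inj hgen hmn (hsol (j, zero)) (hin (j, zero)).2 (hsol (k, zero)) (hin (k, zero)).2 hjk
    have hd := hdisj (Set.mem_range_self j) (Set.mem_range_self k) (fun h => hne (hinj h))
    exact Set.disjoint_left.mp hd (hin (j, zero)).1 (by
      change ζ j ε (0:ℝ) ∈ _
      rw [hz]; exact (hin (k, zero)).1)
  · intro j
    rw [hF]
    simp [zero]
  · intro d q hq hFq
    have hqc := cpY_cont y hycont d q hq
    have hne : ∀ x : Fin N × Set.Ioo (-η) η, (x.2 : ℝ) ≠ 0 → q x = 0 := by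
      intro x hx
      have h1 : F x * q x = 0 := congrFun hFq x
      rw [hF] at h1
      have h2 := cpH_det hgen hmn (fun i => y i x) (fun i => cp_sol_y (hsol x) (hin x).2 i)
      exact (mul_eq_zero.mp h1).resolve_left (mul_ne_zero h2 hx)
    funext ⟨j, t⟩
    by_cases ht : (t : ℝ) = 0
    · -- limit
      let g : ℕ → Set.Ioo (-η) η := fun k => ⟨η / (k + 2), by
        have hk : (0:ℝ) < k + 2 := by positivity
        constructor
        · have : 0 < η / (k + 2) := by positivity
          linarith
        · rw [div_lt_iff₀ hk]
          nlinarith [(Nat.cast_nonneg k : (0:ℝ) ≤ k)]⟩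
      have hg : Filter.Tendsto g Filter.atTop (nhds t) := by
        rw [tendsto_subtype_rng, ht]
        change Filter.Tendsto (fun k : ℕ => η / ((k:ℝ) + 2)) _ _
        exact Filter.Tendsto.div_atTop tendsto_const_nhds
          (Filter.tendsto_atTop_add_const_right _ _ tendsto_natCast_atTop_atTop)
      have h1 : Filter.Tendsto (fun k => q (j, g k)) Filter.atTop (nhds (q (j, t))) :=
        (hqc.tendsto (j, t)).comp (tendsto_const_nhds.prodMk_nhds hg)
      have h2 : (fun k => q (j, g k)) = fun _ => 0 := by
        funext k
        apply hne
        change η / ((k:ℝ) + 2) ≠ 0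
        positivity
      rw [h2] at h1
      exact (tendsto_nhds_unique h1 tendsto_const_nhds)
    · exact hne (j, t) ht
  · intro k
    exact cp_hilb y hgen hmn (fun x => ⟨_, cp_sol_T (hsol x) (hin x).2⟩) c
      (fun x => (cp_eqs (hsol x)).2.1) k
end

/-- **Root count for the primal case (`w = 0`).** The number of nonsingular real
solutions with `μ > 0` of the system `Φ^{A,b,c,u,v,0} = 0` is at most
`2·(n-1)·C(m-1, n)`. -/
theorem primal_root_count
    (m n : ℕ) (hn : 1 ≤ n) (hmn : n < m)
    (A : Matrix (Fin m) (Fin n) ℝ) (hA : A.rank = n)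
    (b : Fin m → ℝ) (c : Fin n → ℝ) (hc : c ≠ 0)
    (u : Fin n → ℝ) (v : Fin m → ℝ) (huv : ¬(u = 0 ∧ v = 0)) :
    Set.encard {z : CPVars ℝ m n |
        0 < z.2.2.2.2.2.2 ∧ cpPhi A b c u v 0 z = 0 ∧
        Function.Bijective (fderiv ℝ (cpPhi A b c u v 0) z)}
      ≤ ((2 * (n - 1) * (m - 1).choose n : ℕ) : ℕ∞) := by
  by_contra hcon
  push Not at hcon
  have h1 : ((2 * (n - 1) * (m - 1).choose n + 1 : ℕ) : ℕ∞) ≤ Set.encard {z : CPVars ℝ m n |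
        0 < z.2.2.2.2.2.2 ∧ cpPhi A b c u v 0 z = 0 ∧
        Function.Bijective (fderiv ℝ (cpPhi A b c u v 0) z)} := by
    rw [Nat.cast_add, Nat.cast_one]
    exact Order.add_one_le_of_lt hcon
  obtain ⟨T, hT, hTc⟩ := Set.exists_subset_encard_eq h1
  have hfin : T.Finite := Set.finite_of_encard_eq_coe hTc
  have hcard : hfin.toFinset.card = 2 * (n - 1) * (m - 1).choose n + 1 := by
    rw [hfin.encard_eq_coe_toFinset_card] at hTc
    exact_mod_cast hTc
  let f := (hfin.toFinset.equivFinOfCardEq hcard).symm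
  have hf : ∀ j, (f j : CPVars ℝ m n) ∈ T := fun j =>
    hfin.mem_toFinset.mp (f j).2
  have := cp_bound hmn A b c u v _ (fun j => (f j : CPVars ℝ m n))
    (Subtype.val_injective.comp f.injective) (fun j => (hT (hf j)).1) (fun j => (hT (hf j)).2.1)
    (fun j => (hT (hf j)).2.2)
  omega
end

section
/- Let m > n ≥ 1 and consider the evaluation map ev sending a tuple (A, b, c, u, v, w, z), where A is a complex m×n matrix, b ∈ ℂ^m, c ∈ ℂ^n, u ∈ ℂ^n, v, w ∈ ℂ^m, and z = (x, s, y, ẋ, ṡ, ẏ, μ) ∈ ℂ^{2n+4m+1}, to Φ^{A,b,c,u,v,w}(z) ∈ ℂ^{2n+4m+1}. At every point where A has rank n, μ ≠ 0, and ev(A,b,c,u,v,w,z) = 0, the total derivative of ev (with respect to all parameters and all variables) is surjective onto ℂ^{2n+4m+1}. In other words, 0 is a regular value of ev on the set where A has rank n and μ ≠ 0. -/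
/-- The space of parameters `(A, b, c, u, v, w)` of the central-path system. -/
abbrev CPParams (K : Type) (m n : ℕ) :=
  (Fin m → Fin n → K) × (Fin m → K) × (Fin n → K) × (Fin n → K) × (Fin m → K) × (Fin m → K)

/-- The evaluation map `(A, b, c, u, v, w; z) ↦ Φ^{A,b,c,u,v,w}(z)`. -/
noncomputable def cpEv {m n : ℕ} (q : CPParams ℂ m n × CPVars ℂ m n) :
    (Fin m → ℂ) × (Fin n → ℂ) × (Fin m → ℂ) × (Fin m → ℂ) × (Fin n → ℂ) × (Fin m → ℂ) × ℂ :=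
  ((fun i => (∑ j, q.1.1 i j * q.2.1 j) - q.2.2.1 i - q.1.2.1 i),
   (fun j => (∑ i, q.1.1 i j * q.2.2.2.1 i) - q.1.2.2.1 j),
   (fun i => q.2.2.1 i * q.2.2.2.1 i - q.2.2.2.2.2.2.2),
   (fun i => (∑ j, q.1.1 i j * q.2.2.2.2.1 j) - q.2.2.2.2.2.1 i),
   (fun j => ∑ i, q.1.1 i j * q.2.2.2.2.2.2.1 i),
   (fun i => q.2.2.2.2.2.1 i * q.2.2.2.1 i + q.2.2.1 i * q.2.2.2.2.2.2.1 i - 1),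
   (∑ j, q.1.2.2.2.1 j * q.2.2.2.2.1 j) + (∑ i, q.1.2.2.2.2.1 i * q.2.2.2.2.2.1 i)
     + (∑ i, q.1.2.2.2.2.2 i * q.2.2.2.2.2.2.1 i))

/-- The explicit directional derivative. -/
noncomputable def cpD {m n : ℕ} (q h : CPParams ℂ m n × CPVars ℂ m n) :
    (Fin m → ℂ) × (Fin n → ℂ) × (Fin m → ℂ) × (Fin m → ℂ) × (Fin n → ℂ) × (Fin m → ℂ) × ℂ :=
  ((fun i => (∑ j, (q.1.1 i j * h.2.1 j + h.1.1 i j * q.2.1 j)) - h.2.2.1 i - h.1.2.1 i),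
   (fun j => (∑ i, (q.1.1 i j * h.2.2.2.1 i + h.1.1 i j * q.2.2.2.1 i)) - h.1.2.2.1 j),
   (fun i => q.2.2.1 i * h.2.2.2.1 i + h.2.2.1 i * q.2.2.2.1 i - h.2.2.2.2.2.2.2),
   (fun i => (∑ j, (q.1.1 i j * h.2.2.2.2.1 j + h.1.1 i j * q.2.2.2.2.1 j)) - h.2.2.2.2.2.1 i),
   (fun j => ∑ i, (q.1.1 i j * h.2.2.2.2.2.2.1 i + h.1.1 i j * q.2.2.2.2.2.2.1 i)),
   (fun i => q.2.2.2.2.2.1 i * h.2.2.2.1 i + h.2.2.2.2.2.1 i * q.2.2.2.1 i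
      + (q.2.2.1 i * h.2.2.2.2.2.2.1 i + h.2.2.1 i * q.2.2.2.2.2.2.1 i)),
   (∑ j, (q.1.2.2.2.1 j * h.2.2.2.2.1 j + h.1.2.2.2.1 j * q.2.2.2.2.1 j))
     + (∑ i, (q.1.2.2.2.2.1 i * h.2.2.2.2.2.1 i + h.1.2.2.2.2.1 i * q.2.2.2.2.2.1 i))
     + (∑ i, (q.1.2.2.2.2.2 i * h.2.2.2.2.2.2.1 i + h.1.2.2.2.2.2 i * q.2.2.2.2.2.2.1 i)))

/-- The quadratic part. -/
noncomputable def cpQ {m n : ℕ} (h : CPParams ℂ m n × CPVars ℂ m n) :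
    (Fin m → ℂ) × (Fin n → ℂ) × (Fin m → ℂ) × (Fin m → ℂ) × (Fin n → ℂ) × (Fin m → ℂ) × ℂ :=
  ((fun i => (∑ j, h.1.1 i j * h.2.1 j)),
   (fun j => (∑ i, h.1.1 i j * h.2.2.2.1 i)),
   (fun i => h.2.2.1 i * h.2.2.2.1 i),
   (fun i => (∑ j, h.1.1 i j * h.2.2.2.2.1 j)),
   (fun j => ∑ i, h.1.1 i j * h.2.2.2.2.2.2.1 i),
   (fun i => h.2.2.2.2.2.1 i * h.2.2.2.1 i + h.2.2.1 i * h.2.2.2.2.2.2.1 i),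
   (∑ j, h.1.2.2.2.1 j * h.2.2.2.2.1 j) + (∑ i, h.1.2.2.2.2.1 i * h.2.2.2.2.2.1 i)
     + (∑ i, h.1.2.2.2.2.2 i * h.2.2.2.2.2.2.1 i))

theorem sum_expand {k : ℕ} (t : ℂ) (a b c d : Fin k → ℂ) :
    ∑ j, (a j + t * c j) * (b j + t * d j)
      = ∑ j, a j * b j + t * ∑ j, (a j * d j + c j * b j) + t^2 * ∑ j, c j * d j := by
  rw [Finset.mul_sum, Finset.mul_sum, ← Finset.sum_add_distrib, ← Finset.sum_add_distrib]
  exact Finset.sum_congr rfl fun j _ => by ring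

theorem cpEv_expand {m n : ℕ} (q h : CPParams ℂ m n × CPVars ℂ m n) (t : ℂ) :
    cpEv (q + t • h) = cpEv q + t • cpD q h + t^2 • cpQ h := by
  simp only [cpEv, cpD, cpQ, Prod.fst_add, Prod.snd_add, Prod.smul_fst, Prod.smul_snd,
    Pi.add_apply, Pi.smul_apply, smul_eq_mul, sum_expand, Prod.smul_mk, Prod.mk_add_mk, Prod.mk.injEq]
  refine ⟨?_, ?_, ?_, ?_, ?_, ?_, ?_⟩ <;> try (ext i)
  all_goals try simp only [Pi.add_apply, Pi.smul_apply, smul_eq_mul]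
  all_goals ring

theorem cpEv_fderiv {m n : ℕ} (q h : CPParams ℂ m n × CPVars ℂ m n) :
    fderiv ℂ (cpEv (m := m) (n := n)) q h = cpD q h := by
  have hd : DifferentiableAt ℂ (cpEv (m := m) (n := n)) q := by
    unfold cpEv
    fun_prop
  have h1 : HasLineDerivAt ℂ (cpEv (m := m) (n := n)) (fderiv ℂ cpEv q h) q h :=
    hd.hasFDerivAt.hasLineDerivAt h
  have h2 : HasLineDerivAt ℂ (cpEv (m := m) (n := n)) (cpD q h) q h := by
    unfold HasLineDerivAt
    simp only [cpEv_expand]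
    have e1 := (hasDerivAt_id (0:ℂ)).smul_const (cpD q h)
    have e2 := ((hasDerivAt_id (0:ℂ)).pow 2).smul_const (cpQ h)
    have := (e1.const_add (cpEv q)).add e2
    convert this using 1
    · funext t
      simp
    · simp
  exact h1.unique h2

theorem dual_sum {m : ℕ} (f : (Fin m → ℂ) →ₗ[ℂ] ℂ) (r : Fin m → ℂ) :
    f r = ∑ i, f (Pi.single i 1) * r i := by
  conv_lhs => rw [pi_eq_sum_univ' r]
  simp [map_sum, mul_comm]
  
theorem core {m n : ℕ} (hm : 0 < m) (A : Fin m → Fin n → ℂ) (s y ds dy : Fin m → ℂ) (dx : Fin n → ℂ)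
    (mu : ℂ) (hmu : mu ≠ 0)
    (hinj : ∀ z : Fin n → ℂ, (∀ i, ∑ j, A i j * z j = 0) → z = 0)
    (z3 : ∀ i, s i * y i = mu) (z4 : ∀ i, ∑ j, A i j * dx j = ds i)
    (z5 : ∀ j, ∑ i, A i j * dy i = 0) (z6 : ∀ i, ds i * y i + s i * dy i = 1)
    (l3 l4 l6 : Fin m → ℂ) (l5 : Fin n → ℂ)
    (ha : ∀ i j, l4 i * dx j + l5 j * dy i = 0)
    (hs : ∀ i, l3 i * y i + l6 i * dy i = 0)
    (hy : ∀ i, l3 i * s i + l6 i * ds i = 0)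
    (hds : ∀ i, l4 i = l6 i * y i)
    (hdy : ∀ i, ∑ j, A i j * l5 j + l6 i * s i = 0) :
    l3 = 0 ∧ l4 = 0 ∧ l5 = 0 ∧ l6 = 0 := by
  have hs0 : ∀ i, s i ≠ 0 := fun i h => hmu (by rw [← z3 i, h, zero_mul])
  have hy0 : ∀ i, y i ≠ 0 := fun i h => hmu (by rw [← z3 i, h, mul_zero])
  have key : ∀ k, l6 k = 0 := by
    by_contra! hk
    obtain ⟨k, hk⟩ := hk
    have e1 : ds k * y k = s k * dy k := by
      apply mul_left_cancel₀ hk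
      linear_combination y k * hy k - s k * hs k
    have hdyk : dy k ≠ 0 := by
      intro h
      have := z6 k
      rw [e1, h] at this
      simp at this
    have hdsk : ds k ≠ 0 := by
      intro h
      have := z6 k
      rw [← e1, h] at this
      simp at this
    have hl4 : l4 k ≠ 0 := by rw [hds]; exact mul_ne_zero hk (hy0 k)
    obtain ⟨t, ht⟩ : ∃ t, t = - dy k / l4 k := ⟨_, rfl⟩
    have ht0 : t ≠ 0 := by rw [ht]; exact div_ne_zero (neg_ne_zero.2 hdyk) hl4
    have htl : t * l4 k = - dy k := by rw [ht]; field_simp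
    have hx : ∀ j, dx j = t * l5 j := fun j => by
      apply mul_left_cancel₀ hl4
      linear_combination ha k j - l5 j * htl
    obtain ⟨j, hj⟩ : ∃ j, l5 j ≠ 0 := by
      by_contra! h
      apply hdsk
      rw [← z4 k]
      simp [hx, h]
    have hdy' : ∀ i, dy i = - t * l4 i := fun i => by
      apply mul_left_cancel₀ hj
      linear_combination ha i j - l4 i * hx j
    have hds' : ∀ i, ds i = - t * (s i * l6 i) := fun i => by
      have : ds i = t * ∑ j, A i j * l5 j := by
        rw [← z4 i, Finset.mul_sum]
        exact Finset.sum_congr rfl fun j _ => by rw [hx]; ring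
      rw [this]
      linear_combination t * hdy i
    have hc : ∀ i, 4 * mu * (ds i * dy i) = 1 := fun i => by
      have a1 : ds i * y i = s i * dy i := by
        rw [hds', hdy', hds]; ring
      have a2 : 2 * (ds i * y i) = 1 := by linear_combination z6 i + a1
      have a3 : 2 * (s i * dy i) = 1 := by linear_combination z6 i - a1
      linear_combination 2 * (s i * dy i) * a2 + a3 - 4 * ds i * dy i * z3 i
    have hsum : ∑ i, ds i * dy i = 0 := by
      calc ∑ i, ds i * dy i = ∑ i, ∑ j, A i j * dx j * dy i := by
            refine Finset.sum_congr rfl fun i _ => ?_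
            rw [← z4 i, Finset.sum_mul]
        _ = ∑ j, dx j * ∑ i, A i j * dy i := by
            rw [Finset.sum_comm]
            refine Finset.sum_congr rfl fun j _ => ?_
            rw [Finset.mul_sum]
            exact Finset.sum_congr rfl fun i _ => by ring
        _ = 0 := by simp [z5]
    have : 4 * mu * ∑ i, ds i * dy i = m := by
      rw [Finset.mul_sum]
      simp [hc]
    rw [hsum, mul_zero] at this
    have hm0 : (m : ℂ) ≠ 0 := by exact_mod_cast hm.ne'
    exact hm0 this.symm
  refine ⟨?_, ?_, ?_, ?_⟩
  · ext i
    have := hs i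
    rw [key i] at this
    simpa [hy0 i] using this
  · ext i
    simp [hds, key]
  · apply hinj
    intro i
    simpa [key] using hdy i
  · ext i
    exact key i

theorem ev_zero_regular_value
    (m n : ℕ) (hn : 1 ≤ n) (hmn : n < m)
    (q : CPParams ℂ m n × CPVars ℂ m n)
    (hrank : (Matrix.of q.1.1).rank = n)
    (hμ : q.2.2.2.2.2.2.2 ≠ 0)
    (hzero : cpEv q = 0) :
    Function.Surjective (fderiv ℂ (cpEv (m := m) (n := n)) q) := by
  by_contra hsurj
  have hlt : LinearMap.range (fderiv ℂ (cpEv (m := m) (n := n)) q).toLinearMap < ⊤ := by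
    rw [lt_top_iff_ne_top]
    intro h
    exact hsurj (LinearMap.range_eq_top.1 h)
  obtain ⟨f, hf, hle⟩ := Submodule.exists_le_ker_of_lt_top _ hlt
  have hD : ∀ h, f (cpD q h) = 0 := fun h => by
    rw [← cpEv_fderiv]
    exact hle ⟨h, rfl⟩
  have hm : 0 < m := by omega
  obtain ⟨l1, l2, l3, l4, l5, l6, l7, hl⟩ : ∃ (l1 : Fin m → ℂ) (l2 : Fin n → ℂ) (l3 l4 : Fin m → ℂ)
      (l5 : Fin n → ℂ) (l6 : Fin m → ℂ) (l7 : ℂ), ∀ r, f r = ∑ i, l1 i * r.1 i + ∑ i, l2 i * r.2.1 i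
        + ∑ i, l3 i * r.2.2.1 i + ∑ i, l4 i * r.2.2.2.1 i + ∑ i, l5 i * r.2.2.2.2.1 i
        + ∑ i, l6 i * r.2.2.2.2.2.1 i + l7 * r.2.2.2.2.2.2 := by
    refine ⟨fun i => f (Pi.single i 1, 0), fun i => f (0, Pi.single i 1, 0),
      fun i => f (0, 0, Pi.single i 1, 0), fun i => f (0, 0, 0, Pi.single i 1, 0),
      fun i => f (0, 0, 0, 0, Pi.single i 1, 0), fun i => f (0, 0, 0, 0, 0, Pi.single i 1, 0),
      f (0, 0, 0, 0, 0, 0, 1), ?_⟩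
    rintro ⟨r1, r2, r3, r4, r5, r6, r7⟩
    have e1 := dual_sum (f ∘ₗ LinearMap.inl ℂ _ _) r1
    have e2 := dual_sum (f ∘ₗ LinearMap.inr ℂ _ _ ∘ₗ LinearMap.inl ℂ _ _) r2
    have e3 := dual_sum (f ∘ₗ LinearMap.inr ℂ _ _ ∘ₗ LinearMap.inr ℂ _ _ ∘ₗ LinearMap.inl ℂ _ _) r3
    have e4 := dual_sum (f ∘ₗ LinearMap.inr ℂ _ _ ∘ₗ LinearMap.inr ℂ _ _ ∘ₗ LinearMap.inr ℂ _ _ ∘ₗ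
      LinearMap.inl ℂ _ _) r4
    have e5 := dual_sum (f ∘ₗ LinearMap.inr ℂ _ _ ∘ₗ LinearMap.inr ℂ _ _ ∘ₗ LinearMap.inr ℂ _ _ ∘ₗ
      LinearMap.inr ℂ _ _ ∘ₗ LinearMap.inl ℂ _ _) r5
    have e6 := dual_sum (f ∘ₗ LinearMap.inr ℂ _ _ ∘ₗ LinearMap.inr ℂ _ _ ∘ₗ LinearMap.inr ℂ _ _ ∘ₗ
      LinearMap.inr ℂ _ _ ∘ₗ LinearMap.inr ℂ _ _ ∘ₗ LinearMap.inl ℂ _ _) r6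
    have e7 : f (0, 0, 0, 0, 0, 0, r7) = f (0, 0, 0, 0, 0, 0, 1) * r7 := by
      rw [mul_comm, ← smul_eq_mul, ← map_smul]
      simp
    simp only [LinearMap.comp_apply, LinearMap.inl_apply, LinearMap.inr_apply] at e1 e2 e3 e4 e5 e6
    rw [← e1, ← e2, ← e3, ← e4, ← e5, ← e6, ← e7]
    simp only [← map_add]
    simp
  obtain ⟨⟨A, b, c, u, v, w⟩, x, s, y, dx, ds, dy, mu⟩ := q
  simp only [cpEv, Prod.mk_eq_zero, funext_iff, Pi.zero_apply] at hzero
  obtain ⟨z1, z2, z3, z4, z5, z6, z7⟩ := hzero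
  simp only [hl, cpD] at hD
  have p1 : ∀ i, l1 i = 0 := fun i => by
    have := hD ((0, Pi.single i 1, 0), 0)
    simpa [Pi.single_apply] using this
  have p2 : ∀ i, l2 i = 0 := fun i => by
    have := hD ((0, 0, Pi.single i 1, 0), 0)
    simpa [Pi.single_apply] using this
  simp only [p1, p2] at hD
  have pv : ∀ i, l7 * ds i = 0 := fun i => by
    have := hD ((0, 0, 0, 0, Pi.single i 1, 0), 0)
    simpa [Pi.single_apply] using this
  have pw : ∀ i, l7 * dy i = 0 := fun i => by
    have := hD ((0, 0, 0, 0, 0, Pi.single i 1), 0)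
    simpa [Pi.single_apply] using this
  have p7 : l7 = 0 := by
    linear_combination y ⟨0, hm⟩ * pv ⟨0, hm⟩ + s ⟨0, hm⟩ * pw ⟨0, hm⟩ - l7 * z6 ⟨0, hm⟩
  subst p7
  have hinj : ∀ z : Fin n → ℂ, (∀ i, ∑ j, A i j * z j = 0) → z = 0 := by
    have hli : LinearIndependent ℂ (Matrix.of A).col := by
      rw [linearIndependent_iff_card_eq_finrank_span, Set.finrank, ← Matrix.rank_eq_finrank_span_cols]
      simpa using hrank.symm
    have hi := Matrix.mulVec_injective_iff.2 hli
    intro z hz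
    apply hi
    rw [Matrix.mulVec_zero]
    ext i
    simpa [Matrix.mulVec, dotProduct] using hz i
  have := core hm A s y ds dy dx mu hμ hinj (fun i => by linear_combination z3 i)
    (fun i => by linear_combination z4 i) z5 (fun i => by linear_combination z6 i) l3 l4 l6 l5
    (fun i j => by
      have := hD ((Pi.single i (Pi.single j 1), 0), 0)
      simp [Pi.single_apply, ite_apply, Finset.sum_ite_eq] at this
      simpa [Pi.single_apply, ite_apply, Finset.sum_ite_eq] using this)
    (fun i => by
      have := hD (0, 0, Pi.single i 1, 0)
      simpa [Pi.single_apply] using this)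
    (fun i => by
      have := hD (0, 0, 0, Pi.single i 1, 0)
      simpa [Pi.single_apply] using this)
    (fun i => by
      have := hD (0, 0, 0, 0, 0, Pi.single i 1, 0)
      simp [Pi.single_apply] at this
      linear_combination -this)
    (fun i => by
      have := hD (0, 0, 0, 0, 0, 0, Pi.single i 1, 0)
      simpa [Pi.single_apply, mul_comm] using this)
  obtain ⟨q3, q4, q5, q6⟩ := this
  apply hf
  refine LinearMap.ext fun r => ?_
  rw [hl]
  simp [p1, p2, q3, q4, q5, q6]
end
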